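/- arXiv:2401.12876 — 9 statements merged into one kernel-verified Lean document; each statement's English description precedes it below -/
import Mathlib

section
/- Let n ≥ 1 and let g : ℝ^n → [1,∞) be a locally bounded, measurable submultiplicative function satisfying the Beurling–Domar condition. Then for every ε > 0 there exists R_ε ∈ (0,∞) such that ∫_{R_ε}^∞ (log g(τx))/τ² dτ < ε for every x ∈ ℝ^n with |x| = 1. -/
open MeasureTheory Set Filter Topology
open scoped ENNReal

/-- If `h` is nonnegative and subadditive, then convergence of `∑ h l / l ^ 2` forces
convergence of `∫ h s / s ^ 2`. -/
theorem setLIntegral_Ioi_one_div_sq_lt_top {h : ℝ → ℝ} {M : ℝ} (h0 : ∀ s, 0 ≤ h s)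
    (hsub : ∀ s t, h (s + t) ≤ h s + h t) (hM : ∀ s, 0 ≤ s → s ≤ 1 → h s ≤ M)
    (hsum : Summable fun l : ℕ => h l / (l : ℝ) ^ 2) :
    ∫⁻ s in Ioi 1, ENNReal.ofReal (h s / s ^ 2) < ∞ := by
  have hM0 : 0 ≤ M := (h0 0).trans (hM 0 le_rfl zero_le_one)
  have hsum' : Summable fun l : ℕ => (h l + M) / (l : ℝ) ^ 2 := by
    have h2 : Summable fun l : ℕ => M * (1 / (l : ℝ) ^ 2) :=
      (Real.summable_one_div_nat_pow.2 one_lt_two).mul_left M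
    refine (hsum.add h2).congr fun l => ?_
    ring
  have hcover : Ioi (1 : ℝ) ⊆ ⋃ l : ℕ, Ico ((l + 1 : ℕ) : ℝ) ((l + 1 : ℕ) + 1) := by
    intro s hs
    have hs1 : (1 : ℝ) ≤ s := le_of_lt hs
    have hfl : 1 ≤ ⌊s⌋₊ := (Nat.one_le_floor_iff s).2 hs1
    refine mem_iUnion.2 ⟨⌊s⌋₊ - 1, ?_⟩
    rw [Nat.sub_add_cancel hfl]
    exact ⟨Nat.floor_le (by linarith), Nat.lt_floor_add_one s⟩
  have hpiece : ∀ l : ℕ, ∫⁻ s in Ico ((l + 1 : ℕ) : ℝ) ((l + 1 : ℕ) + 1),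
      ENNReal.ofReal (h s / s ^ 2) ≤
        ENNReal.ofReal ((h (l + 1 : ℕ) + M) / ((l + 1 : ℕ) : ℝ) ^ 2) := by
    intro l
    have hpos : (0 : ℝ) < (l + 1 : ℕ) := by positivity
    calc _ ≤ ∫⁻ _ in Ico ((l + 1 : ℕ) : ℝ) ((l + 1 : ℕ) + 1),
          ENNReal.ofReal ((h (l + 1 : ℕ) + M) / ((l + 1 : ℕ) : ℝ) ^ 2) := by
          refine setLIntegral_mono measurable_const fun s hs => ENNReal.ofReal_le_ofReal ?_
          have hle : h s ≤ h (l + 1 : ℕ) + M := by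
            have := hsub (l + 1 : ℕ) (s - (l + 1 : ℕ))
            rw [add_sub_cancel] at this
            exact this.trans (by
              gcongr
              exact hM _ (sub_nonneg.2 hs.1) (by linarith [hs.2]))
          have := h0 (l + 1 : ℕ)
          have := hs.1
          gcongr
      _ = _ := by simp
  calc _ ≤ ∫⁻ s in ⋃ l : ℕ, Ico ((l + 1 : ℕ) : ℝ) ((l + 1 : ℕ) + 1),
        ENNReal.ofReal (h s / s ^ 2) := lintegral_mono_set hcover
    _ ≤ ∑' l : ℕ, ∫⁻ s in Ico ((l + 1 : ℕ) : ℝ) ((l + 1 : ℕ) + 1),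
        ENNReal.ofReal (h s / s ^ 2) := lintegral_iUnion_le _ _
    _ ≤ ∑' l : ℕ, ENNReal.ofReal ((h (l + 1 : ℕ) + M) / ((l + 1 : ℕ) : ℝ) ^ 2) :=
        ENNReal.tsum_le_tsum hpiece
    _ < ∞ := ((summable_nat_add_iff 1).2 hsum').tsum_ofReal_lt_top

theorem tendsto_setLIntegral_Ioi_atTop_zero {φ : ℝ → ℝ≥0∞} {a : ℝ}
    (hfin : ∫⁻ s in Ioi a, φ s < ∞) :
    Tendsto (fun T => ∫⁻ s in Ioi T, φ s) atTop (𝓝 0) := by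
  have hInter : ⋂ T : ℝ, Ioi T = ∅ := by
    ext s
    simpa using ⟨s, le_rfl⟩
  have h := tendsto_measure_iInter_atTop (μ := volume.withDensity φ) (s := fun T : ℝ => Ioi T)
    (fun T => measurableSet_Ioi.nullMeasurableSet) (fun _ _ hab => Ioi_subset_Ioi hab)
    ⟨a, by rw [withDensity_apply _ measurableSet_Ioi]; exact hfin.ne⟩
  rw [hInter, measure_empty] at h
  refine h.congr fun T => ?_
  simp [withDensity_apply _ measurableSet_Ioi]

theorem setLIntegral_Ioi_const_div_sq {M R : ℝ} (hM : 0 ≤ M) (hR : 0 < R) :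
    ∫⁻ τ in Ioi R, ENNReal.ofReal (M / τ ^ 2) = ENNReal.ofReal (M / R) := by
  have hfun : ∀ τ ∈ Ioi R, τ ^ (-2 : ℝ) = 1 / τ ^ 2 := fun τ hτ => by
    rw [Real.rpow_neg (hR.trans hτ).le, Real.rpow_two, one_div]
  have hint : IntegrableOn (fun τ : ℝ => M / τ ^ 2) (Ioi R) := by
    have hrpow : IntegrableOn (fun τ : ℝ => M * τ ^ (-2 : ℝ)) (Ioi R) :=
      (integrableOn_Ioi_rpow_of_lt (by norm_num) hR).const_mul M
    refine hrpow.congr_fun (fun τ hτ => ?_) measurableSet_Ioi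
    simp only [hfun τ hτ]
    ring
  rw [← ofReal_integral_eq_lintegral_ofReal hint (ae_of_all _ fun τ => by positivity)]
  congr 1
  calc _ = ∫ τ in Ioi R, M * τ ^ (-2 : ℝ) := by
        refine setIntegral_congr_fun measurableSet_Ioi fun τ hτ => ?_
        simp only [hfun τ hτ]
        ring
    _ = M / R := by
        rw [integral_const_mul, integral_Ioi_rpow_of_lt (by norm_num) hR]
        norm_num [Real.rpow_neg_one]
        ring

theorem lintegral_comp_const_mul {φ : ℝ → ℝ≥0∞} (hφ : Measurable φ) {a : ℝ} (ha : 0 < a) :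
    ∫⁻ τ, φ (a * τ) = ENNReal.ofReal a⁻¹ * ∫⁻ s, φ s := by
  rw [← lintegral_map hφ (measurable_const_mul a), Real.map_volume_mul_left ha.ne',
    lintegral_smul_measure, abs_of_pos (inv_pos.2 ha), smul_eq_mul]

theorem setLIntegral_Ioi_comp_mul_div_sq_le {h : ℝ → ℝ} {M : ℝ} (hmeas : Measurable h)
    (h0 : ∀ s, 0 ≤ h s) (hM : ∀ s, 0 ≤ s → s ≤ 1 → h s ≤ M) {a R : ℝ} (ha : 0 ≤ a)
    (hR : 0 < R) :
    ∫⁻ τ in Ioi R, ENNReal.ofReal (h (a * τ) / τ ^ 2) ≤ ENNReal.ofReal (M / R) +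
      ENNReal.ofReal a * ∫⁻ s in Ioi (max 1 (a * R)), ENNReal.ofReal (h s / s ^ 2) := by
  have hM0 : 0 ≤ M := (h0 0).trans (hM 0 le_rfl zero_le_one)
  rcases ha.eq_or_lt with rfl | ha
  · rw [← setLIntegral_Ioi_const_div_sq hM0 hR]
    refine le_add_right (lintegral_mono fun τ => ENNReal.ofReal_le_ofReal ?_)
    gcongr
    exact hM _ (by simp) (by simp)
  set m := max 1 (a * R)
  set ψ : ℝ → ℝ≥0∞ := (Ioi m).indicator fun s => ENNReal.ofReal (h s / s ^ 2) with hψ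
  have hψm : Measurable ψ :=
    (hmeas.div (measurable_id.pow_const 2)).ennreal_ofReal.indicator measurableSet_Ioi
  have hpt : ∀ τ ∈ Ioi R, ENNReal.ofReal (h (a * τ) / τ ^ 2) ≤
      ENNReal.ofReal (M / τ ^ 2) + ENNReal.ofReal (a ^ 2) * ψ (a * τ) := by
    intro τ hτ
    have hτ0 : 0 < τ := hR.trans hτ
    rcases le_or_gt (a * τ) 1 with h1 | h1
    · refine le_add_right (ENNReal.ofReal_le_ofReal ?_)
      gcongr
      exact hM _ (by positivity) h1
    · refine le_add_left (le_of_eq ?_)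
      have hmem : a * τ ∈ Ioi m := max_lt h1 (mul_lt_mul_of_pos_left hτ ha)
      rw [hψ, indicator_of_mem hmem, ← ENNReal.ofReal_mul (by positivity)]
      congr 1
      field_simp
  calc _ ≤ ∫⁻ τ in Ioi R, (ENNReal.ofReal (M / τ ^ 2) + ENNReal.ofReal (a ^ 2) * ψ (a * τ)) :=
        setLIntegral_mono' measurableSet_Ioi hpt
    _ = ENNReal.ofReal (M / R) + ∫⁻ τ in Ioi R, ENNReal.ofReal (a ^ 2) * ψ (a * τ) := by
        rw [lintegral_add_left (by fun_prop), setLIntegral_Ioi_const_div_sq hM0 hR]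
    _ ≤ ENNReal.ofReal (M / R) + ∫⁻ τ, ENNReal.ofReal (a ^ 2) * ψ (a * τ) := by
        gcongr
        exact Measure.restrict_le_self
    _ = _ := by
        rw [lintegral_const_mul _ (by fun_prop),
          lintegral_comp_const_mul hψm ha, ← mul_assoc, ← ENNReal.ofReal_mul (by positivity),
          hψ, lintegral_indicator measurableSet_Ioi]
        congr 3
        field_simp

theorem eventually_forall_setLIntegral_Ioi_comp_mul_div_sq_le {h : ℝ → ℝ} {M : ℝ}
    (hmeas : Measurable h) (h0 : ∀ s, 0 ≤ h s) (hsub : ∀ s t, h (s + t) ≤ h s + h t)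
    (hM : ∀ s, 0 ≤ s → s ≤ 1 → h s ≤ M)
    (hsum : Summable fun l : ℕ => h l / (l : ℝ) ^ 2) {δ : ℝ≥0∞} (hδ : 0 < δ) :
    ∀ᶠ R in atTop, ∀ a : ℝ, 0 ≤ a → a ≤ 1 →
      ∫⁻ τ in Ioi R, ENNReal.ofReal (h (a * τ) / τ ^ 2) ≤ δ := by
  set I : ℝ → ℝ≥0∞ := fun T => ∫⁻ s in Ioi T, ENNReal.ofReal (h s / s ^ 2) with hI
  have hfin : I 1 < ∞ := setLIntegral_Ioi_one_div_sq_lt_top h0 hsub hM hsum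
  have hIanti : Antitone I := fun _ _ hST => lintegral_mono_set (Ioi_subset_Ioi hST)
  have hlim : Tendsto (fun T : ℝ => ENNReal.ofReal (M / T ^ 2) +
      (ENNReal.ofReal T⁻¹ * I 1 + I T)) atTop (𝓝 0) := by
    have h1 : Tendsto (fun T : ℝ => ENNReal.ofReal (M / T ^ 2)) atTop (𝓝 0) := by
      rw [← ENNReal.ofReal_zero]
      exact ENNReal.tendsto_ofReal
        (tendsto_const_nhds.div_atTop (tendsto_pow_atTop two_ne_zero))
    have h2 : Tendsto (fun T : ℝ => ENNReal.ofReal T⁻¹ * I 1) atTop (𝓝 0) := by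
      have : Tendsto (fun T : ℝ => ENNReal.ofReal T⁻¹) atTop (𝓝 0) := by
        rw [← ENNReal.ofReal_zero]
        exact ENNReal.tendsto_ofReal tendsto_inv_atTop_zero
      simpa using ENNReal.Tendsto.mul_const this (Or.inr hfin.ne)
    simpa using h1.add (h2.add (tendsto_setLIntegral_Ioi_atTop_zero hfin))
  filter_upwards [Real.tendsto_sqrt_atTop.eventually (hlim.eventually (ge_mem_nhds hδ)),
    eventually_gt_atTop 0] with R hRδ hR a ha0 ha1
  have hT : 0 < √R := Real.sqrt_pos.2 hR
  rw [Real.sq_sqrt hR.le] at hRδ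
  refine (setLIntegral_Ioi_comp_mul_div_sq_le hmeas h0 hM ha0 hR).trans (le_trans ?_ hRδ)
  gcongr
  rcases le_total a (√R)⁻¹ with h1 | h1
  · refine le_add_right ?_
    gcongr
    exact hIanti (le_max_left _ _)
  · refine le_add_left ?_
    have h2 : √R ≤ a * R := by
      calc √R = (√R)⁻¹ * R := by
            nth_rewrite 3 [← Real.mul_self_sqrt hR.le]
            field_simp
        _ ≤ a * R := by gcongr
    calc _ ≤ 1 * I (√R) := by
          gcongr
          · exact ENNReal.ofReal_le_one.2 ha1
          · exact hIanti (h2.trans (le_max_right _ _))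
      _ = _ := one_mul _


open MeasureTheory

/-- Lemma `unif`.  Let `g : ℝⁿ → [1,∞)` be a locally bounded, measurable
submultiplicative function satisfying the Beurling–Domar condition.  Then for every `ε > 0`
there is `R_ε ∈ (0,∞)` such that `∫_{R_ε}^∞ log g(τx)/τ² dτ < ε` for all unit vectors `x`. -/
theorem statement0 (n : ℕ) (hn : 1 ≤ n)
    (g : EuclideanSpace ℝ (Fin n) → ℝ)
    (hg1 : ∀ x, 1 ≤ g x)
    (hgmeas : Measurable g)
    (hgloc : ∀ R : ℝ, ∃ C : ℝ, ∀ x, ‖x‖ ≤ R → g x ≤ C)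
    (hgsub : ∀ x y, g (x + y) ≤ g x * g y)
    (hgBD : ∀ x, Summable fun l : ℕ => Real.log (g ((l : ℝ) • x)) / (l : ℝ) ^ 2) :
    ∀ ε : ℝ, 0 < ε → ∃ R : ℝ, 0 < R ∧
      ∀ x : EuclideanSpace ℝ (Fin n), ‖x‖ = 1 →
        ∫⁻ τ in Set.Ioi R, ENNReal.ofReal (Real.log (g (τ • x)) / τ ^ 2) < ENNReal.ofReal ε := by
  intro ε hε
  set f : EuclideanSpace ℝ (Fin n) → ℝ := fun x => Real.log (g x) with hf
  have hf0 : ∀ x, 0 ≤ f x := fun x => Real.log_nonneg (hg1 x)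
  have hgpos : ∀ x, 0 < g x := fun x => zero_lt_one.trans_le (hg1 x)
  have hfsub : ∀ x y, f (x + y) ≤ f x + f y := fun x y => by
    simp only [hf]
    rw [← Real.log_mul (hgpos x).ne' (hgpos y).ne']
    exact Real.log_le_log (hgpos _) (hgsub x y)
  have hfmeas : Measurable f := Real.measurable_log.comp hgmeas
  have hn0 : (0 : ℝ) < n := by exact_mod_cast hn
  have hδ : 0 < ENNReal.ofReal (ε / (4 * n)) := ENNReal.ofReal_pos.2 (by positivity)
  have hray : ∀ u : EuclideanSpace ℝ (Fin n), ∀ᶠ R in atTop, ∀ a : ℝ, 0 ≤ a → a ≤ 1 →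
      ∫⁻ τ in Ioi R, ENNReal.ofReal (f ((a * τ) • u) / τ ^ 2) ≤
        ENNReal.ofReal (ε / (4 * n)) := by
    intro u
    obtain ⟨C, hC⟩ := hgloc ‖u‖
    refine eventually_forall_setLIntegral_Ioi_comp_mul_div_sq_le (h := fun s => f (s • u))
      (M := Real.log C) (by fun_prop) (fun s => hf0 _) (fun s t => ?_) (fun s hs0 hs1 => ?_)
      (hgBD u) hδ
    · rw [add_smul]
      exact hfsub _ _
    · refine Real.log_le_log (hgpos _) (hC _ ?_)
      rw [norm_smul, Real.norm_of_nonneg hs0]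
      exact mul_le_of_le_one_left (norm_nonneg u) hs1
  set e : Fin n → EuclideanSpace ℝ (Fin n) := fun i => EuclideanSpace.single i 1 with he
  obtain ⟨R, hR, hRe⟩ := ((eventually_gt_atTop (0 : ℝ)).and
    (eventually_all.2 fun i => (hray (e i)).and (hray (-e i)))).exists
  refine ⟨R, hR, fun x hx => ?_⟩
  have hcoord : ∀ i (τ : ℝ), f ((τ * x i) • e i) ≤
      f ((|x i| * τ) • e i) + f ((|x i| * τ) • -e i) := by
    intro i τ
    rcases abs_cases (x i) with ⟨hi, -⟩ | ⟨hi, -⟩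
    · rw [hi, mul_comm τ]
      exact le_add_of_nonneg_right (hf0 _)
    · rw [hi, neg_mul, smul_neg, neg_smul, neg_neg, mul_comm τ]
      exact le_add_of_nonneg_left (hf0 _)
  have hdecomp : ∀ τ : ℝ, τ • x = ∑ i, (τ * x i) • e i := by
    intro τ
    ext j
    simp [he, Pi.single_apply]
  have hne : (Finset.univ : Finset (Fin n)).Nonempty := ⟨⟨0, hn⟩, Finset.mem_univ _⟩
  have hpt : ∀ τ : ℝ, ENNReal.ofReal (f (τ • x) / τ ^ 2) ≤
      ∑ i, (ENNReal.ofReal (f ((|x i| * τ) • e i) / τ ^ 2) +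
        ENNReal.ofReal (f ((|x i| * τ) • -e i) / τ ^ 2)) := by
    intro τ
    have hle : f (τ • x) ≤ ∑ i, (f ((|x i| * τ) • e i) + f ((|x i| * τ) • -e i)) := by
      rw [hdecomp]
      exact (Finset.le_sum_nonempty_of_subadditive f hfsub hne _).trans
        (Finset.sum_le_sum fun i _ => hcoord i τ)
    calc _ ≤ ENNReal.ofReal (∑ i, (f ((|x i| * τ) • e i) / τ ^ 2 +
          f ((|x i| * τ) • -e i) / τ ^ 2)) := by
          refine ENNReal.ofReal_le_ofReal ?_
          simp only [← add_div, ← Finset.sum_div]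
          gcongr
      _ = _ := by
          have hq : ∀ y τ, 0 ≤ f y / τ ^ 2 := fun y τ => div_nonneg (hf0 y) (sq_nonneg τ)
          rw [ENNReal.ofReal_sum_of_nonneg fun i _ => add_nonneg (hq _ _) (hq _ _)]
          exact Finset.sum_congr rfl fun i _ => ENNReal.ofReal_add (hq _ _) (hq _ _)
  have hxi : ∀ i, |x i| ≤ 1 := fun i => by
    simpa [hx] using PiLp.norm_apply_le x i
  have hm : ∀ (a : ℝ) (u : EuclideanSpace ℝ (Fin n)),
      Measurable fun τ : ℝ => ENNReal.ofReal (f ((a * τ) • u) / τ ^ 2) := by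
    intro a u
    fun_prop
  calc _ ≤ ∫⁻ τ in Ioi R, ∑ i, (ENNReal.ofReal (f ((|x i| * τ) • e i) / τ ^ 2) +
        ENNReal.ofReal (f ((|x i| * τ) • -e i) / τ ^ 2)) := lintegral_mono hpt
    _ = ∑ i, ((∫⁻ τ in Ioi R, ENNReal.ofReal (f ((|x i| * τ) • e i) / τ ^ 2)) +
        ∫⁻ τ in Ioi R, ENNReal.ofReal (f ((|x i| * τ) • -e i) / τ ^ 2)) := by
        rw [lintegral_finsetSum _ fun i _ => by fun_prop]
        exact Finset.sum_congr rfl fun i _ => lintegral_add_left (hm _ _) _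
    _ ≤ ∑ _i : Fin n, (ENNReal.ofReal (ε / (4 * n)) + ENNReal.ofReal (ε / (4 * n))) :=
        Finset.sum_le_sum fun i _ => add_le_add ((hRe i).1 _ (abs_nonneg _) (hxi i))
          ((hRe i).2 _ (abs_nonneg _) (hxi i))
    _ = ENNReal.ofReal (ε / 2) := by
        rw [← ENNReal.ofReal_add (by positivity) (by positivity), Finset.sum_const,
          Finset.card_univ, Fintype.card_fin, ← ENNReal.ofReal_nsmul, nsmul_eq_mul]
        congr 1
        field_simp
        norm_num
    _ < ENNReal.ofReal ε := (ENNReal.ofReal_lt_ofReal_iff hε).2 (half_lt_self hε)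
end

section
/- Let n ≥ 1, let g : ℝ^n → [1,∞) be a locally bounded, measurable submultiplicative function, and set M := sup_{|y| ≤ 1} log g(y). Then for every x ∈ ℝ^n with |x| = 1 and every integer L ≥ 2 one has (with values in [0,∞]): ∑_{l=L+1}^∞ (log g(l x))/l² − M/L ≤ ∫_L^∞ (log g(τx))/τ² dτ ≤ ∑_{l=L}^∞ (log g(l x))/l² + M/(L−1). -/
open MeasureTheory Set

lemma lintegral_Ioi_natCast_eq_tsum (L : ℕ) (F : ℝ → ENNReal) :
    ∫⁻ τ in Ioi (L : ℝ), F τ =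
      ∑' l : ℕ, ∫⁻ τ in Ioc ((l + L : ℕ) : ℝ) ((l + L + 1 : ℕ) : ℝ), F τ := by
  have hmono : Monotone fun l : ℕ => ((l + L : ℕ) : ℝ) := fun a b hab => by
    simpa using hab
  have hU : Ioi (L : ℝ) = ⋃ l : ℕ, Ioc ((l + L : ℕ) : ℝ) ((l + L + 1 : ℕ) : ℝ) := by
    ext τ
    simp only [mem_Ioi, mem_iUnion, mem_Ioc]
    constructor
    · intro h
      have hc : L < ⌈τ⌉₊ := Nat.lt_ceil.2 h
      refine ⟨⌈τ⌉₊ - L - 1, Nat.lt_ceil.1 (by omega), ?_⟩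
      rw [show ⌈τ⌉₊ - L - 1 + L + 1 = ⌈τ⌉₊ by omega]
      exact Nat.le_ceil τ
    · rintro ⟨l, h, -⟩
      refine lt_of_le_of_lt ?_ h
      exact_mod_cast Nat.le_add_left L l
  have hd := hmono.pairwise_disjoint_on_Ioc_succ
  rw [hU, lintegral_iUnion (fun _ => measurableSet_Ioc)]
  intro a b hab
  have := hd hab
  simpa [Function.onFun, add_right_comm] using this

lemma setLIntegral_const_Ioc_natCast (k : ℕ) (c : ENNReal) :
    ∫⁻ _ in Ioc (k : ℝ) ((k + 1 : ℕ) : ℝ), c = c := by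
  simp

lemma lintegral_Ioi_ofReal_div_sq {M L : ℝ} (hM : 0 ≤ M) (hL : 0 < L) :
    ∫⁻ τ in Ioi L, ENNReal.ofReal (M / τ ^ 2) = ENNReal.ofReal (M / L) := by
  have hfun : EqOn (fun τ : ℝ => M * τ ^ (-2 : ℝ)) (fun τ => M / τ ^ 2) (Ioi L) := by
    intro τ hτ
    have : 0 < τ := hL.trans hτ
    simp [Real.rpow_neg this.le, div_eq_mul_inv]
  have hint : IntegrableOn (fun τ : ℝ => M / τ ^ 2) (Ioi L) :=
    IntegrableOn.congr_fun
      (Integrable.const_mul (integrableOn_Ioi_rpow_of_lt (by norm_num) hL) M)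
      hfun measurableSet_Ioi
  rw [← ofReal_integral_eq_lintegral_ofReal hint (ae_of_all _ fun τ => by positivity),
    ← setIntegral_congr_fun measurableSet_Ioi hfun, integral_const_mul,
    integral_Ioi_rpow_of_lt (by norm_num) hL]
  norm_num [Real.rpow_neg_one, div_eq_mul_inv]

/-- Comparison of `∫_L^∞ f(τ)/τ² dτ` with the corresponding series, for a nonnegative `f` whose
values at points of distance at most one differ by at most `M`. -/
lemma tsum_lintegral_comparison {f : ℝ → ℝ} {M : ℝ} (hf : ∀ t, 0 ≤ f t) (hM : 0 ≤ M)
    (hfM : ∀ s t, |s - t| ≤ 1 → f s ≤ f t + M) {L : ℕ} (hL : 0 < L) :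
    (∑' l : ℕ, ENNReal.ofReal (f ((l + L + 1 : ℕ) : ℝ) / ((l + L + 1 : ℕ) : ℝ) ^ 2) ≤
      (∫⁻ τ in Ioi (L : ℝ), ENNReal.ofReal (f τ / τ ^ 2)) + ENNReal.ofReal (M / L)) ∧
    (∫⁻ τ in Ioi (L : ℝ), ENNReal.ofReal (f τ / τ ^ 2)) ≤
      (∑' l : ℕ, ENNReal.ofReal (f ((l + L : ℕ) : ℝ) / ((l + L : ℕ) : ℝ) ^ 2)) +
        ENNReal.ofReal (M / L) := by
  have hL' : (0 : ℝ) < L := by exact_mod_cast hL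
  have hmeas : Measurable fun τ : ℝ => ENNReal.ofReal (M / τ ^ 2) := by fun_prop
  rw [← lintegral_Ioi_ofReal_div_sq hM hL']
  constructor
  · rw [← lintegral_add_right _ hmeas, lintegral_Ioi_natCast_eq_tsum]
    refine ENNReal.tsum_le_tsum fun l => ?_
    rw [← setLIntegral_const_Ioc_natCast (l + L)
      (ENNReal.ofReal (f ((l + L + 1 : ℕ) : ℝ) / ((l + L + 1 : ℕ) : ℝ) ^ 2))]
    refine setLIntegral_mono' measurableSet_Ioc fun τ hτ => ?_
    have hk : (0 : ℝ) < (l + L : ℕ) := by exact_mod_cast Nat.add_pos_right l hL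
    have hτ0 : 0 < τ := hk.trans hτ.1
    rw [← ENNReal.ofReal_add (div_nonneg (hf _) (sq_nonneg _)) (by positivity), ← add_div]
    refine ENNReal.ofReal_le_ofReal ?_
    have h1 := hτ.1
    have h2 := hτ.2
    refine div_le_div₀ (add_nonneg (hf _) hM) (hfM _ _ ?_) (by positivity) (by gcongr)
    push_cast at h1 h2 ⊢
    rw [abs_le]
    constructor <;> linarith
  · rw [lintegral_Ioi_natCast_eq_tsum, lintegral_Ioi_natCast_eq_tsum, ← ENNReal.tsum_add]
    refine ENNReal.tsum_le_tsum fun l => ?_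
    rw [← setLIntegral_const_Ioc_natCast (l + L)
      (ENNReal.ofReal (f ((l + L : ℕ) : ℝ) / ((l + L : ℕ) : ℝ) ^ 2)),
      ← lintegral_add_right _ hmeas]
    refine setLIntegral_mono' measurableSet_Ioc fun τ hτ => ?_
    have hk : (0 : ℝ) < (l + L : ℕ) := by exact_mod_cast Nat.add_pos_right l hL
    have hτ0 : 0 < τ := hk.trans hτ.1
    have h1 := hτ.1
    have h2 := hτ.2
    rw [← ENNReal.ofReal_add (div_nonneg (hf _) (sq_nonneg _)) (by positivity)]
    refine ENNReal.ofReal_le_ofReal ?_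
    have h3 : f τ ≤ f ((l + L : ℕ) : ℝ) + M := by
      refine hfM _ _ ?_
      push_cast at h1 h2 ⊢
      rw [abs_le]
      constructor <;> linarith
    calc f τ / τ ^ 2 ≤ (f ((l + L : ℕ) : ℝ) + M) / τ ^ 2 := by gcongr
      _ = f ((l + L : ℕ) : ℝ) / τ ^ 2 + M / τ ^ 2 := add_div _ _ _
      _ ≤ _ := by
        gcongr
        exact hf _

/-- estimate `(2.5)` / `\eqref{intsum}`.  For a locally bounded, measurable
submultiplicative `g : ℝⁿ → [1,∞)`, with `M := sup_{|y|≤1} log g(y)`, every unit vector `x`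
and every integer `L ≥ 2` satisfy (with values in `[0,∞]`):
`∑_{l=L+1}^∞ log g(lx)/l² − M/L ≤ ∫_L^∞ log g(τx)/τ² dτ ≤ ∑_{l=L}^∞ log g(lx)/l² + M/(L−1)`. -/
theorem statement1 (n : ℕ) (hn : 1 ≤ n)
    (g : EuclideanSpace ℝ (Fin n) → ℝ)
    (hg1 : ∀ x, 1 ≤ g x)
    (hgmeas : Measurable g)
    (hgloc : ∀ R : ℝ, ∃ C : ℝ, ∀ x, ‖x‖ ≤ R → g x ≤ C)
    (hgsub : ∀ x y, g (x + y) ≤ g x * g y)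
    (M : ℝ)
    (hM : M = sSup ((fun y => Real.log (g y)) ''
      Metric.closedBall (0 : EuclideanSpace ℝ (Fin n)) 1)) :
    ∀ x : EuclideanSpace ℝ (Fin n), ‖x‖ = 1 → ∀ L : ℕ, 2 ≤ L →
      ((∑' l : ℕ, ENNReal.ofReal
            (Real.log (g (((l + L + 1 : ℕ) : ℝ) • x)) / ((l + L + 1 : ℕ) : ℝ) ^ 2))
          - ENNReal.ofReal (M / (L : ℝ))
        ≤ ∫⁻ τ in Set.Ioi (L : ℝ), ENNReal.ofReal (Real.log (g (τ • x)) / τ ^ 2))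
      ∧ (∫⁻ τ in Set.Ioi (L : ℝ), ENNReal.ofReal (Real.log (g (τ • x)) / τ ^ 2)
        ≤ (∑' l : ℕ, ENNReal.ofReal
            (Real.log (g (((l + L : ℕ) : ℝ) • x)) / ((l + L : ℕ) : ℝ) ^ 2))
          + ENNReal.ofReal (M / ((L : ℝ) - 1))) := by
  intro x hx L hL
  have hpos : ∀ y, 0 < g y := fun y => one_pos.trans_le (hg1 y)
  have hlog : ∀ y, 0 ≤ Real.log (g y) := fun y => Real.log_nonneg (hg1 y)
  obtain ⟨C, hC⟩ := hgloc 1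
  have hball : ∀ y, ‖y‖ ≤ 1 → Real.log (g y) ≤ M := by
    intro y hy
    rw [hM]
    refine le_csSup ⟨Real.log C, ?_⟩ ⟨y, by simpa using hy, rfl⟩
    rintro _ ⟨z, hz, rfl⟩
    exact Real.log_le_log (hpos z) (hC z (by simpa using hz))
  have hM0 : 0 ≤ M := (hlog 0).trans (hball 0 (by simp))
  have hfM : ∀ s t : ℝ, |s - t| ≤ 1 →
      Real.log (g (s • x)) ≤ Real.log (g (t • x)) + M := by
    intro s t hst
    have h := hgsub (t • x) ((s - t) • x)
    rw [← add_smul, add_sub_cancel] at h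
    have hlog_le := Real.log_le_log (hpos _) h
    rw [Real.log_mul (hpos _).ne' (hpos _).ne'] at hlog_le
    have := hball ((s - t) • x) (by simpa [norm_smul, hx] using hst)
    linarith
  obtain ⟨hlower, hupper⟩ := tsum_lintegral_comparison (f := fun t => Real.log (g (t • x)))
    (fun t => hlog _) hM0 hfM (show 0 < L by omega)
  refine ⟨tsub_le_iff_right.2 hlower, hupper.trans ?_⟩
  have hL1 : (2 : ℝ) ≤ L := by exact_mod_cast hL
  gcongr
  · linarith
  · linarith
end

section
/- Let n ≥ 1, let g : ℝ^n → [1,∞) be a locally bounded, measurable submultiplicative function satisfying the Beurling–Domar condition, and set M := sup_{|y| ≤ 1} log g(y). Then for every x ∈ ℝ^n with |x| = 1, every r > 1 and every β ∈ (0,1): J_{g,x}(r) ≤ M/r² + I_{g,x}(1)/r^{2(1−β)} + I_{g,x}(r^β). -/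
open MeasureTheory

/-- `I_{g,x}(r) := ∫_{max{r,1}}^∞ log g(τx)/τ² dτ`. -/
noncomputable def Ifun (n : ℕ) (g : EuclideanSpace ℝ (Fin n) → ℝ)
    (x : EuclideanSpace ℝ (Fin n)) (r : ℝ) : ℝ :=
  ∫ τ in Set.Ioi (max r 1), Real.log (g (τ • x)) / τ ^ 2

/-- `J_{g,x}(r) := (max{r,1})⁻² ∫_0^r log g(τx) dτ`. -/
noncomputable def Jfun (n : ℕ) (g : EuclideanSpace ℝ (Fin n) → ℝ)
    (x : EuclideanSpace ℝ (Fin n)) (r : ℝ) : ℝ :=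
  ((max r 1) ^ 2)⁻¹ * ∫ τ in Set.Ioc (0 : ℝ) r, Real.log (g (τ • x))

open Set in
/-- A nonnegative subadditive function on the line which is bounded on `[0, 1]` and for which
`∑ f l / l ^ 2` converges has `f τ / τ ^ 2` integrable at infinity. -/
theorem integrableOn_div_sq_of_subadditive {f : ℝ → ℝ} {M : ℝ} (hf : Measurable f)
    (hf0 : ∀ t, 0 ≤ f t) (hsub : ∀ s t, f (s + t) ≤ f s + f t) (hM : ∀ t ∈ Icc (0 : ℝ) 1, f t ≤ M)
    (hsum : Summable fun l : ℕ => f l / (l : ℝ) ^ 2) :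
    IntegrableOn (fun τ => f τ / τ ^ 2) (Ioi 1) := by
  have hmeas : Measurable fun τ => f τ / τ ^ 2 := hf.div (measurable_id.pow_const 2)
  have hbound (l : ℕ) (τ : ℝ) (hτ : τ ∈ Icc ((l : ℝ) + 1) (l + 2)) :
      ‖f τ / τ ^ 2‖ ≤ (f ((l + 1 : ℕ) : ℝ) + M) / ((l + 1 : ℕ) : ℝ) ^ 2 := by
    have hl : (0 : ℝ) ≤ l := l.cast_nonneg
    have hsplit : f τ ≤ f ((l + 1 : ℕ) : ℝ) + M := by
      have hadd := hsub ((l + 1 : ℕ) : ℝ) (τ - (l + 1 : ℕ))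
      have hle := hM (τ - (l + 1 : ℕ)) ⟨by push_cast; linarith [hτ.1], by
        push_cast; linarith [hτ.2]⟩
      rw [add_sub_cancel] at hadd
      linarith
    rw [Real.norm_of_nonneg (div_nonneg (hf0 τ) (sq_nonneg τ))]
    have hτ1 : ((l + 1 : ℕ) : ℝ) ≤ τ := by push_cast; exact hτ.1
    gcongr
    exact (hf0 τ).trans hsplit
  have hint (l : ℕ) : IntegrableOn (fun τ => f τ / τ ^ 2) (Icc ((l : ℝ) + 1) (l + 2)) :=
    Measure.integrableOn_of_bounded (by simp) hmeas.aestronglyMeasurable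
      ((ae_restrict_iff' measurableSet_Icc).2 (ae_of_all _ (hbound l)))
  have hsq : Summable fun l : ℕ => M / ((l + 1 : ℕ) : ℝ) ^ 2 := by
    have := (Real.summable_one_div_nat_pow.2 one_lt_two).mul_left M
    simpa only [mul_one_div] using (summable_nat_add_iff 1).2 this
  have hmajor : Summable fun l : ℕ =>
      (f ((l + 1 : ℕ) : ℝ) + M) / ((l + 1 : ℕ) : ℝ) ^ 2 := by
    simpa only [add_div] using ((summable_nat_add_iff 1).2 hsum).add hsq
  have hnorm : Summable fun l : ℕ => ∫ τ in Icc ((l : ℝ) + 1) (l + 2), ‖f τ / τ ^ 2‖ := by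
    refine hmajor.of_nonneg_of_le (fun l => integral_nonneg fun τ => norm_nonneg _) fun l => ?_
    calc ∫ τ in Icc ((l : ℝ) + 1) (l + 2), ‖f τ / τ ^ 2‖
        ≤ ∫ _ in Icc ((l : ℝ) + 1) (l + 2),
            (f ((l + 1 : ℕ) : ℝ) + M) / ((l + 1 : ℕ) : ℝ) ^ 2 :=
          setIntegral_mono_on (hint l).norm (by simp) measurableSet_Icc (hbound l)
      _ = (f ((l + 1 : ℕ) : ℝ) + M) / ((l + 1 : ℕ) : ℝ) ^ 2 := by
          rw [setIntegral_const, Real.volume_real_Icc_of_le (by linarith)]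
          norm_num
  refine (integrableOn_iUnion_of_summable_integral_norm hint hnorm).mono_set fun τ hτ => ?_
  have hτ1 : (1 : ℝ) < τ := hτ
  have hfloor := Nat.floor_le (show (0 : ℝ) ≤ τ - 1 by linarith)
  have hlt := Nat.lt_floor_add_one (τ - 1)
  exact mem_iUnion.2 ⟨⌊τ - 1⌋₊, by linarith, by linarith⟩

open Set in
/-- Comparison of the integral of `f` over `(a, b]` with that of `f τ / τ ^ 2` over `(a, ∞)`. -/
theorem setIntegral_Ioc_le_sq_mul_setIntegral_Ioi {f : ℝ → ℝ} {a b : ℝ} (hf0 : ∀ t, 0 ≤ f t)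
    (ha : 0 ≤ a) (hloc : IntegrableOn f (Ioc a b))
    (hint : IntegrableOn (fun τ => f τ / τ ^ 2) (Ioi a)) :
    ∫ τ in Ioc a b, f τ ≤ b ^ 2 * ∫ τ in Ioi a, f τ / τ ^ 2 := by
  calc ∫ τ in Ioc a b, f τ
      ≤ ∫ τ in Ioc a b, b ^ 2 * (f τ / τ ^ 2) := by
        refine setIntegral_mono_on hloc ((hint.mono_set Ioc_subset_Ioi_self).const_mul _)
          measurableSet_Ioc fun τ hτ => ?_
        have hτ0 : 0 < τ := ha.trans_lt hτ.1
        rw [← mul_div_assoc, le_div_iff₀ (by positivity), mul_comm]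
        exact mul_le_mul_of_nonneg_right (pow_le_pow_left₀ hτ0.le hτ.2 2) (hf0 τ)
    _ = b ^ 2 * ∫ τ in Ioc a b, f τ / τ ^ 2 := integral_const_mul _ _
    _ ≤ b ^ 2 * ∫ τ in Ioi a, f τ / τ ^ 2 := by
        refine mul_le_mul_of_nonneg_left (setIntegral_mono_set hint ?_ ?_) (sq_nonneg b)
        · exact ae_of_all _ fun τ => div_nonneg (hf0 τ) (sq_nonneg τ)
        · exact Ioc_subset_Ioi_self.eventuallyLE

open Set in
/-- Splitting `(0, r]` at `1` and at an intermediate point `s`. -/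
theorem setIntegral_Ioc_le_of_integrableOn_div_sq {f : ℝ → ℝ} {M r s : ℝ} (hf0 : ∀ t, 0 ≤ f t)
    (hM : ∀ t ∈ Icc (0 : ℝ) 1, f t ≤ M) (hloc : IntegrableOn f (Ioc 0 r))
    (hint : IntegrableOn (fun τ => f τ / τ ^ 2) (Ioi 1)) (hs : 1 ≤ s) (hsr : s ≤ r) :
    ∫ τ in Ioc 0 r, f τ ≤
      M + s ^ 2 * (∫ τ in Ioi 1, f τ / τ ^ 2) + r ^ 2 * ∫ τ in Ioi s, f τ / τ ^ 2 := by
  have hs0 : 0 ≤ s := zero_le_one.trans hs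
  have h01 : IntegrableOn f (Ioc 0 1) := hloc.mono_set (Ioc_subset_Ioc_right (hs.trans hsr))
  have h1s : IntegrableOn f (Ioc 1 s) := hloc.mono_set (Ioc_subset_Ioc zero_le_one hsr)
  have hsr' : IntegrableOn f (Ioc s r) := hloc.mono_set (Ioc_subset_Ioc_left hs0)
  have hunit : ∫ τ in Ioc (0 : ℝ) 1, f τ ≤ M := by
    calc ∫ τ in Ioc (0 : ℝ) 1, f τ ≤ ∫ _ in Ioc (0 : ℝ) 1, M :=
          setIntegral_mono_on h01 (by simp) measurableSet_Ioc
            fun τ hτ => hM τ (Ioc_subset_Icc_self hτ)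
      _ = M := by simp
  have hmid := setIntegral_Ioc_le_sq_mul_setIntegral_Ioi hf0 zero_le_one h1s hint
  have hlast := setIntegral_Ioc_le_sq_mul_setIntegral_Ioi hf0 hs0 hsr'
    (hint.mono_set (Ioi_subset_Ioi hs))
  rw [← Ioc_union_Ioc_eq_Ioc hs0 hsr, setIntegral_union (Ioc_disjoint_Ioc_of_le le_rfl)
    measurableSet_Ioc (hloc.mono_set (Ioc_subset_Ioc_right hsr)) hsr',
    ← Ioc_union_Ioc_eq_Ioc zero_le_one hs, setIntegral_union (Ioc_disjoint_Ioc_of_le le_rfl)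
    measurableSet_Ioc h01 h1s]
  linarith

/-- estimate `\eqref{JIx}`:
`J_{g,x}(r) ≤ M/r² + I_{g,x}(1)/r^{2(1−β)} + I_{g,x}(r^β)` for `r > 1`, `β ∈ (0,1)`. -/
theorem statement2 (n : ℕ) (hn : 1 ≤ n)
    (g : EuclideanSpace ℝ (Fin n) → ℝ)
    (hg1 : ∀ x, 1 ≤ g x)
    (hgmeas : Measurable g)
    (hgloc : ∀ R : ℝ, ∃ C : ℝ, ∀ x, ‖x‖ ≤ R → g x ≤ C)
    (hgsub : ∀ x y, g (x + y) ≤ g x * g y)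
    (hgBD : ∀ x, Summable fun l : ℕ => Real.log (g ((l : ℝ) • x)) / (l : ℝ) ^ 2)
    (M : ℝ)
    (hM : M = sSup ((fun y => Real.log (g y)) ''
      Metric.closedBall (0 : EuclideanSpace ℝ (Fin n)) 1)) :
    ∀ x : EuclideanSpace ℝ (Fin n), ‖x‖ = 1 → ∀ r : ℝ, 1 < r → ∀ β ∈ Set.Ioo (0 : ℝ) 1,
      Jfun n g x r ≤ M / r ^ 2 + Ifun n g x 1 / r ^ (2 * (1 - β)) + Ifun n g x (r ^ β) := by
  intro x hx r hr β hβ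
  set f : ℝ → ℝ := fun τ => Real.log (g (τ • x)) with hf
  have hfmeas : Measurable f :=
    Real.measurable_log.comp (hgmeas.comp (measurable_id.smul_const x))
  have hf0 (t : ℝ) : 0 ≤ f t := Real.log_nonneg (hg1 _)
  have hgpos (y : EuclideanSpace ℝ (Fin n)) : 0 < g y := zero_lt_one.trans_le (hg1 y)
  have hfsub (s t : ℝ) : f (s + t) ≤ f s + f t := by
    simp only [hf, add_smul]
    rw [← Real.log_mul (hgpos _).ne' (hgpos _).ne']
    exact Real.log_le_log (hgpos _) (hgsub _ _)
  have hnorm {t : ℝ} (ht : 0 ≤ t) : ‖t • x‖ = t := by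
    rw [norm_smul, hx, mul_one, Real.norm_of_nonneg ht]
  have hfM : ∀ t ∈ Set.Icc (0 : ℝ) 1, f t ≤ M := by
    intro t ht
    obtain ⟨C, hC⟩ := hgloc 1
    rw [hM]
    refine le_csSup ⟨Real.log C, ?_⟩ ⟨t • x, ?_, rfl⟩
    · rintro _ ⟨y, hy, rfl⟩
      exact Real.log_le_log (hgpos y) (hC y (mem_closedBall_zero_iff.1 hy))
    · rw [mem_closedBall_zero_iff, hnorm ht.1]
      exact ht.2
  have hloc : IntegrableOn f (Set.Ioc 0 r) := by
    obtain ⟨C, hC⟩ := hgloc r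
    refine Measure.integrableOn_of_bounded (M := Real.log C) (by simp)
      hfmeas.aestronglyMeasurable
      ((ae_restrict_iff' measurableSet_Ioc).2 (ae_of_all _ fun τ hτ => ?_))
    rw [Real.norm_of_nonneg (hf0 τ)]
    exact Real.log_le_log (hgpos _) (hC _ ((hnorm hτ.1.le).trans_le hτ.2))
  have hint := integrableOn_div_sq_of_subadditive hfmeas hf0 hfsub hfM (hgBD x)
  have hr0 : 0 < r := zero_lt_one.trans hr
  have hs : 1 ≤ r ^ β := Real.one_le_rpow hr.le hβ.1.le
  have hsr : r ^ β ≤ r := by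
    simpa using Real.rpow_le_rpow_of_exponent_le hr.le hβ.2.le
  have hmain := setIntegral_Ioc_le_of_integrableOn_div_sq hf0 hfM hloc hint hs hsr
  have hpow : r ^ (2 * (1 - β)) = r ^ 2 / (r ^ β) ^ 2 := by
    rw [mul_sub, mul_one, Real.rpow_sub hr0, Real.rpow_two, mul_comm, Real.rpow_mul hr0.le,
      Real.rpow_two]
  unfold Jfun Ifun
  rw [max_eq_left hr.le, max_self, max_eq_left hs, hpow, inv_mul_le_iff₀ (by positivity)]
  refine hmain.trans_eq ?_
  have hsne : r ^ β ≠ 0 := (zero_lt_one.trans_le hs).ne'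
  simp only [hf]
  field_simp
end

section
/- Let n ≥ 1 and let g : ℝ^n → [1,∞) be a locally bounded, measurable submultiplicative function satisfying the Beurling–Domar condition. Then for every x ∈ ℝ^n with |x| = 1 and every r > 1: (1/2)(I_{g,x}(r) + J_{g,x}(r) + I_{g,−x}(r) + J_{g,−x}(r)) ≤ π S_{g,x}(r) ≤ I_{g,x}(r) + J_{g,x}(r) + I_{g,−x}(r) + J_{g,−x}(r). -/
open MeasureTheory

/-- `S_{g,x}(r) := (1/π) ∫_{−∞}^∞ log g(τx)/(τ² + max{r,1}²) dτ`. -/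
noncomputable def Sfun (n : ℕ) (g : EuclideanSpace ℝ (Fin n) → ℝ)
    (x : EuclideanSpace ℝ (Fin n)) (r : ℝ) : ℝ :=
  Real.pi⁻¹ * ∫ τ : ℝ, Real.log (g (τ • x)) / (τ ^ 2 + (max r 1) ^ 2)

/-- A nonnegative measurable function that exceeds its value at `l` by at most `C` on
`[l, l + 1]` is integrable against `τ⁻²` near infinity as soon as `∑ f l / l²` converges. -/
theorem integrableOn_div_sq_of_summable {f : ℝ → ℝ} (hf0 : ∀ t, 0 ≤ f t) (hfm : Measurable f)
    {C : ℝ} (hfC : ∀ (l : ℕ) (t : ℝ), (l : ℝ) ≤ t → t ≤ l + 1 → f t ≤ f l + C)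
    (hs : Summable fun l : ℕ => f l / (l : ℝ) ^ 2) {r : ℝ} (hr : 1 < r) :
    IntegrableOn (fun t => f t / t ^ 2) (Set.Ioi r) := by
  have hm : Measurable fun t => f t / t ^ 2 := hfm.div (measurable_id.pow_const 2)
  have hbound : ∀ l : ℕ, ∀ t ∈ Set.Ico ((l : ℝ) + 1) (l + 2),
      ‖f t / t ^ 2‖ ≤ f (l + 1) / ((l : ℝ) + 1) ^ 2 + C / ((l : ℝ) + 1) ^ 2 := by
    intro l t ht
    have hl : (0 : ℝ) ≤ l := l.cast_nonneg
    have h1 : f t ≤ f (l + 1) + C := by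
      have := hfC (l + 1) t (by push_cast; exact ht.1) (by push_cast; linarith [ht.2])
      simpa using this
    rw [Real.norm_of_nonneg (div_nonneg (hf0 t) (sq_nonneg t)), ← add_div]
    have h2 : 0 ≤ f (l + 1) + C := (hf0 t).trans h1
    have h3 := ht.1
    gcongr
  have hint : ∀ l : ℕ, IntegrableOn (fun t => f t / t ^ 2) (Set.Ico ((l : ℝ) + 1) (l + 2)) := by
    intro l
    refine Measure.integrableOn_of_bounded (by simp) hm.aestronglyMeasurable
      ((ae_restrict_iff' measurableSet_Ico).2 (Filter.Eventually.of_forall (hbound l)))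
  have hsub : Set.Ioi r ⊆ ⋃ l : ℕ, Set.Ico ((l : ℝ) + 1) (l + 2) := by
    intro t ht
    have ht1 : 0 ≤ t - 1 := by linarith [Set.mem_Ioi.1 ht]
    refine Set.mem_iUnion.2 ⟨⌊t - 1⌋₊, ?_, ?_⟩
    · linarith [Nat.floor_le ht1]
    · linarith [Nat.lt_floor_add_one (t - 1)]
  refine IntegrableOn.mono_set ?_ hsub
  refine integrableOn_iUnion_of_summable_integral_norm hint ?_
  have hs1 : Summable fun l : ℕ => f (l + 1) / ((l : ℝ) + 1) ^ 2 := by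
    simpa using (summable_nat_add_iff 1).2 hs
  have hs2 : Summable fun l : ℕ => C / ((l : ℝ) + 1) ^ 2 := by
    have h := (summable_nat_add_iff 1).2 (Real.summable_one_div_nat_pow.2 one_lt_two)
    simpa [div_eq_mul_inv] using h.mul_left C
  refine Summable.of_nonneg_of_le (fun l => integral_nonneg fun t => norm_nonneg _) ?_
    (hs1.add hs2)
  intro l
  have h := norm_setIntegral_le_of_norm_le_const (μ := volume) (s := Set.Ico ((l : ℝ) + 1) (l + 2))
    (f := fun t => ‖f t / t ^ 2‖) (by simp)
    (fun t ht => by rw [norm_norm]; exact hbound l t ht)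
  have hv : volume.real (Set.Ico ((l : ℝ) + 1) (l + 2)) = 1 := by
    rw [Measure.real, Real.volume_Ico, ENNReal.toReal_ofReal] <;> linarith
  rw [hv, mul_one] at h
  exact (le_abs_self _).trans h

/-- On the half-line, the kernel `1 / (τ² + r²)` is comparable, with constants `1 / 2` and `1`, to
the kernel equal to `1 / r²` on `(0, r]` and to `1 / τ²` on `(r, ∞)`. -/
theorem integral_Ioi_div_sq_add_sq_bounds {f : ℝ → ℝ} (hf0 : ∀ t, 0 ≤ f t) (hfm : Measurable f)
    {r : ℝ} (hr : 0 < r) (h0 : IntegrableOn f (Set.Ioc 0 r))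
    (hi : IntegrableOn (fun t => f t / t ^ 2) (Set.Ioi r)) :
    IntegrableOn (fun t => f t / (t ^ 2 + r ^ 2)) (Set.Ioi 0) ∧
    (1 / 2) * ((∫ t in Set.Ioi r, f t / t ^ 2) + (r ^ 2)⁻¹ * ∫ t in Set.Ioc 0 r, f t)
      ≤ ∫ t in Set.Ioi 0, f t / (t ^ 2 + r ^ 2) ∧
    ∫ t in Set.Ioi 0, f t / (t ^ 2 + r ^ 2)
      ≤ (∫ t in Set.Ioi r, f t / t ^ 2) + (r ^ 2)⁻¹ * ∫ t in Set.Ioc 0 r, f t := by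
  have hm : Measurable fun t => f t / (t ^ 2 + r ^ 2) :=
    hfm.div ((measurable_id.pow_const 2).add_const _)
  have hnn : ∀ t, 0 ≤ f t / (t ^ 2 + r ^ 2) := fun t => div_nonneg (hf0 t) (by positivity)
  have u0 : ∀ t ∈ Set.Ioc 0 r, f t / (t ^ 2 + r ^ 2) ≤ (r ^ 2)⁻¹ * f t := by
    intro t _
    rw [div_eq_mul_inv, mul_comm]
    refine mul_le_mul_of_nonneg_right (inv_anti₀ (by positivity) ?_) (hf0 t)
    linarith [sq_nonneg t]
  have l0 : ∀ t ∈ Set.Ioc 0 r, (1 / 2) * ((r ^ 2)⁻¹ * f t) ≤ f t / (t ^ 2 + r ^ 2) := by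
    intro t ht
    have h : t ^ 2 ≤ r ^ 2 := pow_le_pow_left₀ ht.1.le ht.2 2
    rw [← mul_assoc, one_div, ← mul_inv, div_eq_mul_inv, mul_comm (f t)]
    exact mul_le_mul_of_nonneg_right (inv_anti₀ (by positivity) (by linarith)) (hf0 t)
  have u1 : ∀ t ∈ Set.Ioi r, f t / (t ^ 2 + r ^ 2) ≤ f t / t ^ 2 := by
    intro t ht
    have htp : 0 < t := hr.trans ht
    exact div_le_div_of_nonneg_left (hf0 t) (by positivity) (by linarith [sq_nonneg r])
  have l1 : ∀ t ∈ Set.Ioi r, (1 / 2) * (f t / t ^ 2) ≤ f t / (t ^ 2 + r ^ 2) := by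
    intro t ht
    have htp : 0 < t := hr.trans ht
    have h : r ^ 2 ≤ t ^ 2 := pow_le_pow_left₀ hr.le (Set.mem_Ioi.1 ht).le 2
    rw [one_div_mul_eq_div, div_div]
    exact div_le_div_of_nonneg_left (hf0 t) (by positivity) (by linarith)
  have j0 : IntegrableOn (fun t => f t / (t ^ 2 + r ^ 2)) (Set.Ioc 0 r) := by
    refine Integrable.mono' (h0.const_mul (r ^ 2)⁻¹) hm.aestronglyMeasurable
      ((ae_restrict_iff' measurableSet_Ioc).2 (Filter.Eventually.of_forall fun t ht => ?_))
    rw [Real.norm_of_nonneg (hnn t)]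
    exact u0 t ht
  have j1 : IntegrableOn (fun t => f t / (t ^ 2 + r ^ 2)) (Set.Ioi r) := by
    refine Integrable.mono' hi hm.aestronglyMeasurable
      ((ae_restrict_iff' measurableSet_Ioi).2 (Filter.Eventually.of_forall fun t ht => ?_))
    rw [Real.norm_of_nonneg (hnn t)]
    exact u1 t ht
  have hsplit : ∫ t in Set.Ioi 0, f t / (t ^ 2 + r ^ 2) =
      (∫ t in Set.Ioc 0 r, f t / (t ^ 2 + r ^ 2)) + ∫ t in Set.Ioi r, f t / (t ^ 2 + r ^ 2) := by
    rw [← setIntegral_union (Set.Ioc_disjoint_Ioi le_rfl) measurableSet_Ioi j0 j1,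
      Set.Ioc_union_Ioi_eq_Ioi hr.le]
  have U0 := setIntegral_mono_on j0 (h0.const_mul (r ^ 2)⁻¹) measurableSet_Ioc u0
  have L0 := setIntegral_mono_on ((h0.const_mul (r ^ 2)⁻¹).const_mul (1 / 2)) j0
    measurableSet_Ioc l0
  have U1 := setIntegral_mono_on j1 hi measurableSet_Ioi u1
  have L1 := setIntegral_mono_on (hi.const_mul (1 / 2)) j1 measurableSet_Ioi l1
  simp only [integral_const_mul] at U0 L0 L1
  refine ⟨?_, ?_, ?_⟩
  · rw [← Set.Ioc_union_Ioi_eq_Ioi hr.le]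
    exact j0.union j1
  · rw [hsplit]; linarith
  · rw [hsplit]; linarith

/-- estimates `\eqref{upperx}` and `\eqref{lowerx}`:
`(1/2)(I_{g,x}(r)+J_{g,x}(r)+I_{g,−x}(r)+J_{g,−x}(r)) ≤ π S_{g,x}(r)
  ≤ I_{g,x}(r)+J_{g,x}(r)+I_{g,−x}(r)+J_{g,−x}(r)` for unit `x` and `r > 1`. -/
theorem statement3 (n : ℕ) (hn : 1 ≤ n)
    (g : EuclideanSpace ℝ (Fin n) → ℝ)
    (hg1 : ∀ x, 1 ≤ g x)
    (hgmeas : Measurable g)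
    (hgloc : ∀ R : ℝ, ∃ C : ℝ, ∀ x, ‖x‖ ≤ R → g x ≤ C)
    (hgsub : ∀ x y, g (x + y) ≤ g x * g y)
    (hgBD : ∀ x, Summable fun l : ℕ => Real.log (g ((l : ℝ) • x)) / (l : ℝ) ^ 2) :
    ∀ x : EuclideanSpace ℝ (Fin n), ‖x‖ = 1 → ∀ r : ℝ, 1 < r →
      (1 / 2) * (Ifun n g x r + Jfun n g x r + Ifun n g (-x) r + Jfun n g (-x) r)
          ≤ Real.pi * Sfun n g x r
      ∧ Real.pi * Sfun n g x r
          ≤ Ifun n g x r + Jfun n g x r + Ifun n g (-x) r + Jfun n g (-x) r := by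
  have hlog0 : ∀ y, 0 ≤ Real.log (g y) := fun y => Real.log_nonneg (hg1 y)
  have key : ∀ (x : EuclideanSpace ℝ (Fin n)), ‖x‖ = 1 → ∀ r : ℝ, 1 < r →
      (Measurable fun t : ℝ => Real.log (g (t • x))) ∧
      IntegrableOn (fun t : ℝ => Real.log (g (t • x))) (Set.Ioc 0 r) ∧
      IntegrableOn (fun t : ℝ => Real.log (g (t • x)) / t ^ 2) (Set.Ioi r) := by
    intro x hx r hr
    have hm : Measurable fun t : ℝ => Real.log (g (t • x)) :=
      Real.measurable_log.comp (hgmeas.comp (measurable_id.smul_const x))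
    have hbd : ∀ R : ℝ, ∃ C, ∀ t : ℝ, 0 ≤ t → t ≤ R → Real.log (g (t • x)) ≤ C := by
      intro R
      obtain ⟨C, hC⟩ := hgloc R
      refine ⟨Real.log C, fun t ht htR => Real.log_le_log (by linarith [hg1 (t • x)]) (hC _ ?_)⟩
      rwa [norm_smul, hx, mul_one, Real.norm_of_nonneg ht]
    refine ⟨hm, ?_, ?_⟩
    · obtain ⟨C, hC⟩ := hbd r
      refine Measure.integrableOn_of_bounded (M := C) (by simp) hm.aestronglyMeasurable
        ((ae_restrict_iff' measurableSet_Ioc).2 (Filter.Eventually.of_forall fun t ht => ?_))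
      rw [Real.norm_of_nonneg (hlog0 _)]
      exact hC t ht.1.le ht.2
    · obtain ⟨C, hC⟩ := hbd 1
      refine integrableOn_div_sq_of_summable (C := C) (fun t => hlog0 _) hm ?_ (hgBD x) hr
      intro l t hl ht
      have hlt := hC (t - l) (by linarith) (by linarith)
      have hpos : ∀ y, g y ≠ 0 := fun y => by linarith [hg1 y]
      have hsum := hgsub ((l : ℝ) • x) ((t - l) • x)
      rw [← add_smul, add_sub_cancel] at hsum
      have := Real.log_le_log (by linarith [hg1 (t • x)]) hsum
      rw [Real.log_mul (hpos _) (hpos _)] at this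
      linarith
  intro x hx r hr
  have hmax : max r 1 = r := max_eq_left hr.le
  obtain ⟨hm, h0, hi⟩ := key x hx r hr
  obtain ⟨hm', h0', hi'⟩ := key (-x) (by rwa [norm_neg]) r hr
  obtain ⟨k, kl, ku⟩ := integral_Ioi_div_sq_add_sq_bounds (fun t => hlog0 _) hm
    (by linarith) h0 hi
  obtain ⟨k', kl', ku'⟩ := integral_Ioi_div_sq_add_sq_bounds (fun t => hlog0 _) hm'
    (by linarith) h0' hi'
  let F : ℝ → ℝ := fun t => Real.log (g (t • x)) / (t ^ 2 + r ^ 2)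
  have hF : (fun t : ℝ => Real.log (g (t • -x)) / (t ^ 2 + r ^ 2)) = fun t => F (-t) := by
    funext t
    simp [F]
  rw [hF] at k' kl' ku'
  have k'' : IntegrableOn F (Set.Iic 0) := by
    rw [← neg_zero, ← Set.neg_Ici]
    exact ((Measure.measurePreserving_neg volume).integrableOn_comp_preimage
      (MeasurableEquiv.neg ℝ).measurableEmbedding (f := F)).1
      (by simpa [integrableOn_Ici_iff_integrableOn_Ioi, Function.comp_def] using k')
  have hS : Real.pi * Sfun n g x r = (∫ t in Set.Ioi 0, F t) + ∫ t in Set.Ioi 0, F (-t) := by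
    rw [Sfun, mul_inv_cancel_left₀ Real.pi_ne_zero, hmax, integral_comp_neg_Ioi, neg_zero, add_comm]
    exact (intervalIntegral.integral_Iic_add_Ioi k'' k).symm
  simp only [Ifun, Jfun, hmax, hS]
  constructor <;> linarith
end

section
/- Let n ≥ 1 and let g : ℝ^n → [1,∞) be a locally bounded, measurable submultiplicative function satisfying the Beurling–Domar condition. Then for every r > 1 one has (1/(2π)) max{I_g(r), J_g(r)} ≤ S_g(r) ≤ (2/π)(I_g(r) + J_g(r)), and S_g(r) → 0 as r → ∞. -/
open MeasureTheory

/-- `I_g(r) := sup_{x ∈ S^{n−1}} I_{g,x}(r)`. -/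
noncomputable def Isup (n : ℕ) (g : EuclideanSpace ℝ (Fin n) → ℝ) (r : ℝ) : ℝ :=
  ⨆ x : Metric.sphere (0 : EuclideanSpace ℝ (Fin n)) 1, Ifun n g (x : EuclideanSpace ℝ (Fin n)) r

/-- `J_g(r) := sup_{x ∈ S^{n−1}} J_{g,x}(r)`. -/
noncomputable def Jsup (n : ℕ) (g : EuclideanSpace ℝ (Fin n) → ℝ) (r : ℝ) : ℝ :=
  ⨆ x : Metric.sphere (0 : EuclideanSpace ℝ (Fin n)) 1, Jfun n g (x : EuclideanSpace ℝ (Fin n)) r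

/-- `S_g(r) := sup_{x ∈ S^{n−1}} S_{g,x}(r)`. -/
noncomputable def Ssup (n : ℕ) (g : EuclideanSpace ℝ (Fin n) → ℝ) (r : ℝ) : ℝ :=
  ⨆ x : Metric.sphere (0 : EuclideanSpace ℝ (Fin n)) 1, Sfun n g (x : EuclideanSpace ℝ (Fin n)) r

open Set Filter Topology

/-- A nonnegative, measurable, locally bounded, subadditive function on the line which is summable
against `l⁻²` along the integers. -/
structure IsBeurlingDomarLog (f : ℝ → ℝ) : Prop where
  measurable : Measurable f
  nonneg : ∀ s, 0 ≤ f s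
  subadd : ∀ s t, f (s + t) ≤ f s + f t
  locallyBounded : ∀ R : ℝ, ∃ C : ℝ, ∀ s, |s| ≤ R → f s ≤ C
  summable_pos : Summable fun l : ℕ => f l / (l : ℝ) ^ 2
  summable_neg : Summable fun l : ℕ => f (-l) / (l : ℝ) ^ 2

namespace IsBeurlingDomarLog

variable {f : ℝ → ℝ}

theorem comp_neg (hf : IsBeurlingDomarLog f) : IsBeurlingDomarLog fun s => f (-s) where
  measurable := hf.measurable.comp measurable_neg
  nonneg s := hf.nonneg _
  subadd s t := by rw [neg_add]; exact hf.subadd _ _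
  locallyBounded R := by
    obtain ⟨C, hC⟩ := hf.locallyBounded R
    exact ⟨C, fun s hs => hC _ (by rwa [abs_neg])⟩
  summable_pos := hf.summable_neg
  summable_neg := by simpa using hf.summable_pos

theorem integrableOn_Ioc (hf : IsBeurlingDomarLog f) (a b : ℝ) :
    IntegrableOn f (Ioc a b) := by
  obtain ⟨C, hC⟩ := hf.locallyBounded (max |a| |b|)
  refine Measure.integrableOn_of_bounded (M := C) measure_Ioc_lt_top.ne
    hf.measurable.aestronglyMeasurable ?_
  filter_upwards [ae_restrict_mem measurableSet_Ioc] with s hs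
  rw [Real.norm_of_nonneg (hf.nonneg s)]
  exact hC s (abs_le_max_abs_abs hs.1.le hs.2)

theorem integrableOn_Ioi_div_sq (hf : IsBeurlingDomarLog f) :
    IntegrableOn (fun s => f s / s ^ 2) (Ioi 1) := by
  obtain ⟨C, hC⟩ := hf.locallyBounded 1
  have hmeas : Measurable fun s => f s / s ^ 2 := hf.measurable.div (by fun_prop)
  have hbound : ∀ i : ℕ, ∀ s ∈ Ico ((i : ℝ) + 1) (i + 2),
      ‖f s / s ^ 2‖ ≤ (f ((i : ℝ) + 1) + C) / ((i : ℝ) + 1) ^ 2 := by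
    intro i s hs
    have hi : (0 : ℝ) < (i : ℝ) + 1 := by positivity
    rw [Real.norm_of_nonneg (div_nonneg (hf.nonneg s) (sq_nonneg s))]
    have h1 : f s ≤ f ((i : ℝ) + 1) + C := by
      have h := hf.subadd ((i : ℝ) + 1) (s - (i + 1))
      rw [add_sub_cancel] at h
      have := hC (s - (i + 1)) (by rw [abs_le]; constructor <;> linarith [hs.1, hs.2])
      linarith
    have h0 := hf.nonneg s
    have := hs.1
    gcongr
    linarith
  have hcover : Ioi (1 : ℝ) ⊆ ⋃ i : ℕ, Ico ((i : ℝ) + 1) (i + 2) := by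
    intro s hs
    have hs : (1 : ℝ) < s := hs
    have h1 := Nat.floor_le (show 0 ≤ s - 1 by linarith)
    have h2 := Nat.lt_floor_add_one (s - 1)
    exact mem_iUnion.2 ⟨⌊s - 1⌋₊, by linarith, by linarith⟩
  refine IntegrableOn.mono_set ?_ hcover
  have hint : ∀ i : ℕ, IntegrableOn (fun s => f s / s ^ 2) (Ico ((i : ℝ) + 1) (i + 2)) := by
    intro i
    refine Measure.integrableOn_of_bounded (M := (f ((i : ℝ) + 1) + C) / ((i : ℝ) + 1) ^ 2)
      measure_Ico_lt_top.ne hmeas.aestronglyMeasurable ?_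
    filter_upwards [ae_restrict_mem measurableSet_Ico] with s hs using hbound i s hs
  refine integrableOn_iUnion_of_summable_integral_norm hint ?_
  have hsum : Summable fun i : ℕ => (f ((i : ℝ) + 1) + C) / ((i : ℝ) + 1) ^ 2 := by
    have h1 := (summable_nat_add_iff 1).2 hf.summable_pos
    have h2 := ((summable_nat_add_iff 1).2
      (Real.summable_one_div_nat_pow.2 one_lt_two)).mul_left C
    refine (h1.add h2).congr fun i => ?_
    push_cast
    ring
  refine hsum.of_nonneg_of_le (fun i => integral_nonneg fun s => norm_nonneg _) fun i => ?_
  calc ∫ s in Ico ((i : ℝ) + 1) (i + 2), ‖f s / s ^ 2‖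
      ≤ ∫ s in Ico ((i : ℝ) + 1) (i + 2), (f ((i : ℝ) + 1) + C) / ((i : ℝ) + 1) ^ 2 :=
        setIntegral_mono_on (hint i).norm (integrableOn_const measure_Ico_lt_top.ne)
          measurableSet_Ico (hbound i)
    _ = (f ((i : ℝ) + 1) + C) / ((i : ℝ) + 1) ^ 2 := by
        rw [setIntegral_const, Real.volume_real_Ico_of_le (by linarith)]
        norm_num

theorem integrable_indicator_div_sq (hf : IsBeurlingDomarLog f) :
    Integrable fun s => {s : ℝ | 1 < |s|}.indicator f s / s ^ 2 := by
  have hpos := hf.integrableOn_Ioi_div_sq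
  have hneg := hf.comp_neg.integrableOn_Ioi_div_sq.integrable_indicator measurableSet_Ioi
  have hneg' := hneg.comp_neg
  refine ((hpos.integrable_indicator measurableSet_Ioi).add hneg').congr (.of_forall fun s => ?_)
  simp only [Pi.add_apply, indicator, mem_Ioi, mem_ofPred_eq, lt_abs]
  by_cases h1 : 1 < s
  · have h2 : ¬ 1 < -s := by linarith
    simp [h1, h2]
  · by_cases h2 : 1 < -s <;> simp [h1, h2]

theorem _root_.integrable_one_div_sq_add_sq {r : ℝ} (hr : 1 ≤ r) :
    Integrable fun s : ℝ => 1 / (s ^ 2 + r ^ 2) := by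
  have hm : Measurable fun s : ℝ => 1 / (s ^ 2 + r ^ 2) := by fun_prop
  refine integrable_inv_one_add_sq.mono' hm.aestronglyMeasurable (.of_forall fun s => ?_)
  rw [Real.norm_of_nonneg (by positivity), ← one_div]
  apply one_div_le_one_div_of_le (by positivity)
  nlinarith

theorem indicator_nonneg (hf : IsBeurlingDomarLog f) (s : ℝ) :
    0 ≤ {s : ℝ | 1 < |s|}.indicator f s :=
  Set.indicator_nonneg (fun _ _ => hf.nonneg _) s

theorem measurable_indicator (hf : IsBeurlingDomarLog f) :
    Measurable ({s : ℝ | 1 < |s|}.indicator f) :=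
  hf.measurable.indicator (measurableSet_lt measurable_const (by fun_prop))

theorem le_add_indicator {C : ℝ} (hC : ∀ s, |s| ≤ 1 → f s ≤ C) (hC0 : 0 ≤ C) (s : ℝ) :
    f s ≤ C + {s : ℝ | 1 < |s|}.indicator f s := by
  by_cases h : 1 < |s|
  · rw [indicator_of_mem (by exact h)]; linarith
  · rw [indicator_of_notMem (by exact h), add_zero]; exact hC s (not_lt.1 h)

theorem exists_bound (hf : IsBeurlingDomarLog f) :
    ∃ C, 0 ≤ C ∧ ∀ s, |s| ≤ 1 → f s ≤ C := by
  obtain ⟨C, hC⟩ := hf.locallyBounded 1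
  exact ⟨C, (hf.nonneg 0).trans (hC 0 (by simp)), hC⟩

theorem integrable_indicator_div_sq_add_sq (hf : IsBeurlingDomarLog f) (r : ℝ) :
    Integrable fun s => {s : ℝ | 1 < |s|}.indicator f s / (s ^ 2 + r ^ 2) := by
  refine hf.integrable_indicator_div_sq.mono'
    (hf.measurable_indicator.div (by fun_prop)).aestronglyMeasurable (.of_forall fun s => ?_)
  rw [Real.norm_of_nonneg (div_nonneg (hf.indicator_nonneg s) (by positivity))]
  by_cases h : s = 0
  · subst h; simp
  · have := hf.indicator_nonneg s
    gcongr
    nlinarith [sq_nonneg r]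

theorem integrable_div_sq_add_sq (hf : IsBeurlingDomarLog f) {r : ℝ} (hr : 1 ≤ r) :
    Integrable fun s => f s / (s ^ 2 + r ^ 2) := by
  obtain ⟨C, hC0, hC⟩ := hf.exists_bound
  refine (((integrable_one_div_sq_add_sq hr).const_mul C).add
    (hf.integrable_indicator_div_sq_add_sq r)).mono'
    (hf.measurable.div (by fun_prop)).aestronglyMeasurable (.of_forall fun s => ?_)
  rw [Real.norm_of_nonneg (div_nonneg (hf.nonneg s) (by positivity)), Pi.add_apply,
    mul_one_div, ← add_div]
  gcongr
  exact le_add_indicator hC hC0 s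

/-- The Poisson-type integrals of the dilates `f (c ·)`, `|c| ≤ 1`, decay uniformly in `c`. -/
theorem exists_tendsto_integral_comp_mul_le (hf : IsBeurlingDomarLog f) :
    ∃ K : ℝ → ℝ, Tendsto K atTop (𝓝 0) ∧ ∀ c, |c| ≤ 1 → ∀ r, 1 ≤ r →
      Integrable (fun s => f (c * s) / (s ^ 2 + r ^ 2)) ∧
      ∫ s, f (c * s) / (s ^ 2 + r ^ 2) ≤ K r := by
  obtain ⟨C, hC0, hC⟩ := hf.exists_bound
  set W := {s : ℝ | 1 < |s|}.indicator f with hW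
  have hW0 : ∀ s, 0 ≤ W s := hf.indicator_nonneg
  have hWm : Measurable W := hf.measurable_indicator
  have hWint : Integrable fun s => W s / s ^ 2 := hf.integrable_indicator_div_sq
  have hWzero : W 0 = 0 := by simp [hW]
  have hinv : Tendsto (fun r : ℝ => r⁻¹) atTop (𝓝 0) := tendsto_inv_atTop_zero
  have hker0 : ∀ r s : ℝ, 1 ≤ r → 0 ≤ min (s ^ 2)⁻¹ r⁻¹ := fun r s hr => by positivity
  refine ⟨fun r => C * (∫ s, 1 / (s ^ 2 + r ^ 2)) + ∫ s, W s * min (s ^ 2)⁻¹ r⁻¹, ?_, ?_⟩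
  · have h1 : Tendsto (fun r : ℝ => ∫ s : ℝ, 1 / (s ^ 2 + r ^ 2)) atTop (𝓝 (∫ _ : ℝ, (0 : ℝ))) := by
      refine tendsto_integral_filter_of_dominated_convergence (fun s => 1 / (s ^ 2 + 1 ^ 2))
        (.of_forall fun r => ?_) ?_ (integrable_one_div_sq_add_sq le_rfl)
        (.of_forall fun s => ?_)
      · have hm : Measurable fun s : ℝ => 1 / (s ^ 2 + r ^ 2) := by fun_prop
        exact hm.aestronglyMeasurable
      · filter_upwards [eventually_ge_atTop 1] with r hr
        refine .of_forall fun s => ?_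
        rw [Real.norm_of_nonneg (by positivity)]
        gcongr
      · refine squeeze_zero' (g := fun r : ℝ => r⁻¹) (.of_forall fun r => by positivity) ?_ hinv
        filter_upwards [eventually_ge_atTop 1] with r hr
        rw [← one_div]
        apply one_div_le_one_div_of_le (by positivity)
        nlinarith [sq_nonneg s]
    have h2 : Tendsto (fun r : ℝ => ∫ s, W s * min (s ^ 2)⁻¹ r⁻¹) atTop
        (𝓝 (∫ _ : ℝ, (0 : ℝ))) := by
      refine tendsto_integral_filter_of_dominated_convergence (fun s => W s / s ^ 2)
        (.of_forall fun r => (hWm.mul (by fun_prop)).aestronglyMeasurable) ?_ hWint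
        (.of_forall fun s => ?_)
      · filter_upwards [eventually_ge_atTop 1] with r hr
        refine .of_forall fun s => ?_
        rw [Real.norm_of_nonneg (mul_nonneg (hW0 s) (hker0 r s hr)), div_eq_mul_inv]
        exact mul_le_mul_of_nonneg_left (min_le_left _ _) (hW0 s)
      · have : Tendsto (fun r : ℝ => W s * r⁻¹) atTop (𝓝 0) := by
          simpa using hinv.const_mul (W s)
        refine squeeze_zero' ?_ ?_ this
        · filter_upwards [eventually_ge_atTop 1] with r hr
          exact mul_nonneg (hW0 s) (hker0 r s hr)
        · exact .of_forall fun r => mul_le_mul_of_nonneg_left (min_le_right _ _) (hW0 s)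
    simpa using (h1.const_mul C).add h2
  · intro c hc r hr
    have hKint : Integrable fun s => W s * min (s ^ 2)⁻¹ r⁻¹ := by
      refine hWint.mono' (hWm.mul (by fun_prop)).aestronglyMeasurable (.of_forall fun s => ?_)
      rw [Real.norm_of_nonneg (mul_nonneg (hW0 s) (hker0 r s hr)), div_eq_mul_inv]
      exact mul_le_mul_of_nonneg_left (min_le_left _ _) (hW0 s)
    have hdil : Integrable (fun s => W (c * s) / (s ^ 2 + r ^ 2)) ∧
        ∫ s, W (c * s) / (s ^ 2 + r ^ 2) ≤ ∫ s, W s * min (s ^ 2)⁻¹ r⁻¹ := by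
      rcases eq_or_ne c 0 with rfl | hc0
      · simp only [zero_mul, hWzero, zero_div, integral_zero]
        exact ⟨integrable_zero _ _ _, integral_nonneg fun s => mul_nonneg (hW0 s) (hker0 r s hr)⟩
      have hcpos : 0 < |c| := abs_pos.2 hc0
      set G : ℝ → ℝ := fun s => W s / ((c⁻¹ * s) ^ 2 + r ^ 2) with hG
      have hGc : (fun s => W (c * s) / (s ^ 2 + r ^ 2)) = fun s => G (c * s) := by
        funext s
        simp [hG, inv_mul_cancel_left₀ hc0]
      have hGm : Measurable G := hWm.div (by fun_prop)
      have hG0 : ∀ s, 0 ≤ G s := fun s => div_nonneg (hW0 s) (by positivity)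
      have hle : ∀ s, |c⁻¹| * G s ≤ W s * min (s ^ 2)⁻¹ r⁻¹ := by
        intro s
        by_cases hs : 1 < |s|
        · have hker : |c⁻¹| * ((c⁻¹ * s) ^ 2 + r ^ 2)⁻¹ = |c| * (s ^ 2 + |c| ^ 2 * r ^ 2)⁻¹ := by
            have hs2 : (c⁻¹ * s) ^ 2 = s ^ 2 / |c| ^ 2 := by rw [sq_abs]; field_simp
            rw [abs_inv, hs2]
            have : 0 < s ^ 2 + |c| ^ 2 * r ^ 2 := by positivity
            field_simp
          have hs0 : 0 < s ^ 2 := by rw [← sq_abs]; positivity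
          have hmin : |c| * (s ^ 2 + |c| ^ 2 * r ^ 2)⁻¹ ≤ min (s ^ 2)⁻¹ r⁻¹ := by
            have hden : 0 < s ^ 2 + |c| ^ 2 * r ^ 2 := by positivity
            rw [← div_eq_mul_inv, ← one_div, ← one_div]
            refine le_min ?_ ?_
            · rw [div_le_div_iff₀ hden hs0]
              nlinarith [sq_nonneg (|c| * r)]
            · rw [div_le_div_iff₀ hden (by linarith)]
              nlinarith [sq_nonneg (|s| - |c| * r), sq_abs s, mul_pos hcpos (by linarith : 0 < r)]
          calc |c⁻¹| * G s = W s * (|c⁻¹| * ((c⁻¹ * s) ^ 2 + r ^ 2)⁻¹) := by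
                simp only [hG, div_eq_mul_inv]; ring
            _ ≤ _ := by rw [hker]; exact mul_le_mul_of_nonneg_left hmin (hW0 s)
        · have : W s = 0 := indicator_of_notMem (by exact hs) f
          simp [hG, this]
      have hGint' : Integrable fun s => |c⁻¹| * G s := by
        refine hKint.mono' (hGm.const_mul _).aestronglyMeasurable (.of_forall fun s => ?_)
        rw [Real.norm_of_nonneg (mul_nonneg (abs_nonneg _) (hG0 s))]
        exact hle s
      have hGint : Integrable G :=
        (integrable_const_mul_iff (abs_pos.2 (inv_ne_zero hc0)).ne'.isUnit G).1 hGint'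
      rw [hGc]
      refine ⟨hGint.comp_mul_left' hc0, ?_⟩
      rw [Measure.integral_comp_mul_left, smul_eq_mul, ← integral_const_mul]
      exact integral_mono hGint' hKint hle
    have hsum := ((integrable_one_div_sq_add_sq hr).const_mul C).add hdil.1
    have hle : ∀ s, f (c * s) / (s ^ 2 + r ^ 2) ≤
        C * (1 / (s ^ 2 + r ^ 2)) + W (c * s) / (s ^ 2 + r ^ 2) := by
      intro s
      rw [mul_one_div, ← add_div]
      gcongr
      exact le_add_indicator hC hC0 _
    have hint : Integrable fun s => f (c * s) / (s ^ 2 + r ^ 2) := by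
      refine hsum.mono' ((hf.measurable.comp (measurable_const_mul c)).div
        (by fun_prop)).aestronglyMeasurable (.of_forall fun s => ?_)
      rw [Real.norm_of_nonneg (div_nonneg (hf.nonneg _) (by positivity))]
      exact hle s
    refine ⟨hint, ?_⟩
    calc ∫ s, f (c * s) / (s ^ 2 + r ^ 2)
        ≤ ∫ s, (C * (1 / (s ^ 2 + r ^ 2)) + W (c * s) / (s ^ 2 + r ^ 2)) :=
          integral_mono hint hsum hle
      _ = C * (∫ s, 1 / (s ^ 2 + r ^ 2)) + ∫ s, W (c * s) / (s ^ 2 + r ^ 2) := by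
          rw [integral_add ((integrable_one_div_sq_add_sq hr).const_mul C) hdil.1,
            integral_const_mul]
      _ ≤ _ := add_le_add_right hdil.2 _

theorem integral_Ioi_div_sq_le (hf : IsBeurlingDomarLog f) {r : ℝ} (hr : 1 ≤ r) :
    ∫ s in Ioi r, f s / s ^ 2 ≤ 2 * ∫ s, f s / (s ^ 2 + r ^ 2) := by
  have hS := hf.integrable_div_sq_add_sq hr
  rw [← integral_const_mul]
  refine le_trans ?_ (setIntegral_le_integral (s := Ioi r) (hS.const_mul 2) (.of_forall fun s =>
    mul_nonneg zero_le_two (div_nonneg (hf.nonneg s) (by positivity))))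
  refine setIntegral_mono_on (hf.integrableOn_Ioi_div_sq.mono_set (Ioi_subset_Ioi hr))
    (hS.const_mul 2).integrableOn measurableSet_Ioi fun s hs => ?_
  have hs : r < s := hs
  have h0 := hf.nonneg s
  rw [← mul_div_assoc, div_le_div_iff₀ (by nlinarith) (by nlinarith)]
  nlinarith [mul_nonneg h0 (by nlinarith : 0 ≤ s ^ 2 - r ^ 2)]

theorem inv_sq_mul_integral_Ioc_le (hf : IsBeurlingDomarLog f) {r : ℝ} (hr : 1 ≤ r) :
    (r ^ 2)⁻¹ * ∫ s in Ioc 0 r, f s ≤ 2 * ∫ s, f s / (s ^ 2 + r ^ 2) := by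
  have hS := hf.integrable_div_sq_add_sq hr
  rw [← integral_const_mul, ← integral_const_mul]
  refine le_trans ?_ (setIntegral_le_integral (s := Ioc 0 r) (hS.const_mul 2) (.of_forall fun s =>
    mul_nonneg zero_le_two (div_nonneg (hf.nonneg s) (by positivity))))
  refine setIntegral_mono_on ((hf.integrableOn_Ioc 0 r).const_mul _)
    (hS.const_mul 2).integrableOn measurableSet_Ioc fun s hs => ?_
  have h0 := hf.nonneg s
  have h1 : s ^ 2 ≤ r ^ 2 := pow_le_pow_left₀ hs.1.le hs.2 2
  rw [inv_mul_eq_div, ← mul_div_assoc, div_le_div_iff₀ (by positivity) (by positivity)]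
  nlinarith [mul_nonneg h0 (by linarith : 0 ≤ r ^ 2 - s ^ 2)]

theorem setIntegral_Ioi_zero_le (hf : IsBeurlingDomarLog f) {r : ℝ} (hr : 1 ≤ r) :
    ∫ s in Ioi 0, f s / (s ^ 2 + r ^ 2) ≤
      (∫ s in Ioi r, f s / s ^ 2) + (r ^ 2)⁻¹ * ∫ s in Ioc 0 r, f s := by
  have hS := hf.integrable_div_sq_add_sq hr
  have hr0 : 0 ≤ r := by linarith
  rw [← Ioc_union_Ioi_eq_Ioi hr0, setIntegral_union (Ioc_disjoint_Ioi le_rfl) measurableSet_Ioi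
    hS.integrableOn hS.integrableOn, add_comm, ← integral_const_mul]
  refine add_le_add ?_ ?_
  · refine setIntegral_mono_on hS.integrableOn
      (hf.integrableOn_Ioi_div_sq.mono_set (Ioi_subset_Ioi hr)) measurableSet_Ioi fun s hs => ?_
    have hs : r < s := hs
    have h0 := hf.nonneg s
    have : 0 < s := by linarith
    gcongr
    nlinarith
  · refine setIntegral_mono_on hS.integrableOn ((hf.integrableOn_Ioc 0 r).const_mul _)
      measurableSet_Ioc fun s hs => ?_
    have h0 := hf.nonneg s
    rw [inv_mul_eq_div]
    gcongr
    nlinarith [sq_nonneg s]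

theorem integral_div_sq_add_sq_le (hf : IsBeurlingDomarLog f) {r : ℝ} (hr : 1 ≤ r) :
    ∫ s, f s / (s ^ 2 + r ^ 2) ≤
      ((∫ s in Ioi r, f s / s ^ 2) + (r ^ 2)⁻¹ * ∫ s in Ioc 0 r, f s) +
      ((∫ s in Ioi r, f (-s) / s ^ 2) + (r ^ 2)⁻¹ * ∫ s in Ioc 0 r, f (-s)) := by
  have hS := hf.integrable_div_sq_add_sq hr
  have hneg : ∫ s in Iic 0, f s / (s ^ 2 + r ^ 2) = ∫ s in Ioi 0, f (-s) / (s ^ 2 + r ^ 2) := by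
    have := integral_comp_neg_Ioi (0 : ℝ) fun s => f s / (s ^ 2 + r ^ 2)
    simpa using this.symm
  rw [← intervalIntegral.integral_Iic_add_Ioi (b := 0) hS.integrableOn hS.integrableOn, hneg,
    add_comm]
  exact add_le_add (hf.setIntegral_Ioi_zero_le hr) (hf.comp_neg.setIntegral_Ioi_zero_le hr)

end IsBeurlingDomarLog

theorem isBeurlingDomarLog_log_smul {n : ℕ} {g : EuclideanSpace ℝ (Fin n) → ℝ}
    (hg1 : ∀ x, 1 ≤ g x) (hgmeas : Measurable g)
    (hgloc : ∀ R : ℝ, ∃ C : ℝ, ∀ x, ‖x‖ ≤ R → g x ≤ C)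
    (hgsub : ∀ x y, g (x + y) ≤ g x * g y)
    (hgBD : ∀ x, Summable fun l : ℕ => Real.log (g ((l : ℝ) • x)) / (l : ℝ) ^ 2)
    (x : EuclideanSpace ℝ (Fin n)) :
    IsBeurlingDomarLog fun s => Real.log (g (s • x)) where
  measurable := Real.measurable_log.comp (hgmeas.comp (measurable_id.smul_const x))
  nonneg s := Real.log_nonneg (hg1 _)
  subadd s t := by
    have h1 := hg1 (s • x)
    have h2 := hg1 (t • x)
    rw [← Real.log_mul (by linarith) (by linarith), add_smul]
    exact Real.log_le_log (by linarith [hg1 (s • x + t • x)]) (hgsub _ _)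
  locallyBounded R := by
    obtain ⟨C, hC⟩ := hgloc (R * ‖x‖)
    refine ⟨Real.log C, fun s hs => Real.log_le_log (by linarith [hg1 (s • x)]) (hC _ ?_)⟩
    rw [norm_smul, Real.norm_eq_abs]
    gcongr
  summable_pos := hgBD x
  summable_neg := by simpa using hgBD (-x)

theorem log_smul_le_sum {n : ℕ} (hn : 1 ≤ n) {g : EuclideanSpace ℝ (Fin n) → ℝ}
    (hg1 : ∀ x, 1 ≤ g x) (hgsub : ∀ x y, g (x + y) ≤ g x * g y)
    (x : EuclideanSpace ℝ (Fin n)) (s : ℝ) :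
    Real.log (g (s • x)) ≤
      ∑ j, Real.log (g ((x j * s) • EuclideanSpace.single j (1 : ℝ))) := by
  have hx : s • x = ∑ j, (x j * s) • EuclideanSpace.single j (1 : ℝ) := by
    ext i
    simp [mul_comm, Finset.sum_apply, Pi.single_apply]
  have : NeZero n := ⟨by omega⟩
  conv_lhs => rw [hx]
  refine Finset.le_sum_nonempty_of_subadditive (fun y => Real.log (g y)) (fun y z => ?_)
    Finset.univ_nonempty _
  have h1 := hg1 y
  have h2 := hg1 z
  rw [← Real.log_mul (by linarith) (by linarith)]
  exact Real.log_le_log (by linarith [hg1 (y + z)]) (hgsub _ _)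

/-- for `r > 1`, `(1/(2π)) max{I_g(r), J_g(r)} ≤ S_g(r) ≤ (2/π)(I_g(r)+J_g(r))`,
and `S_g(r) → 0` as `r → ∞`. -/
theorem statement4 (n : ℕ) (hn : 1 ≤ n)
    (g : EuclideanSpace ℝ (Fin n) → ℝ)
    (hg1 : ∀ x, 1 ≤ g x)
    (hgmeas : Measurable g)
    (hgloc : ∀ R : ℝ, ∃ C : ℝ, ∀ x, ‖x‖ ≤ R → g x ≤ C)
    (hgsub : ∀ x y, g (x + y) ≤ g x * g y)
    (hgBD : ∀ x, Summable fun l : ℕ => Real.log (g ((l : ℝ) • x)) / (l : ℝ) ^ 2) :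
    (∀ r : ℝ, 1 < r →
      (2 * Real.pi)⁻¹ * max (Isup n g r) (Jsup n g r) ≤ Ssup n g r
      ∧ Ssup n g r ≤ (2 / Real.pi) * (Isup n g r + Jsup n g r))
    ∧ Filter.Tendsto (Ssup n g) Filter.atTop (nhds 0) := by
  have hpi := Real.pi_pos
  have hf := isBeurlingDomarLog_log_smul hg1 hgmeas hgloc hgsub hgBD
  have hf0 : ∀ y, 0 ≤ Real.log (g y) := fun y => Real.log_nonneg (hg1 y)
  choose K hK0 hK using fun j : Fin n =>
    (hf (EuclideanSpace.single j (1 : ℝ))).exists_tendsto_integral_comp_mul_le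
  have hS0 : ∀ x r, 0 ≤ Sfun n g x r := fun x r =>
    mul_nonneg (by positivity) (integral_nonneg fun s => div_nonneg (hf0 _) (by positivity))
  have hI0 : ∀ x r, 0 ≤ Ifun n g x r := fun x r =>
    integral_nonneg fun s => div_nonneg (hf0 _) (by positivity)
  have hJ0 : ∀ x r, 0 ≤ Jfun n g x r := fun x r =>
    mul_nonneg (by positivity) (integral_nonneg fun s => hf0 _)
  have hSK : ∀ r, 1 ≤ r → ∀ x : Metric.sphere (0 : EuclideanSpace ℝ (Fin n)) 1,
      Sfun n g x r ≤ Real.pi⁻¹ * ∑ j, K j r := by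
    intro r hr x
    have hx : ∀ j, |(x : EuclideanSpace ℝ (Fin n)) j| ≤ 1 := fun j => by
      have := PiLp.norm_apply_le (x : EuclideanSpace ℝ (Fin n)) j
      rwa [norm_eq_of_mem_sphere x, Real.norm_eq_abs] at this
    rw [Sfun, max_eq_left hr]
    gcongr
    calc ∫ s, Real.log (g (s • (x : EuclideanSpace ℝ (Fin n)))) / (s ^ 2 + r ^ 2)
        ≤ ∫ s, ∑ j, Real.log (g (((x : EuclideanSpace ℝ (Fin n)) j * s) •
            EuclideanSpace.single j (1 : ℝ))) / (s ^ 2 + r ^ 2) := by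
          refine integral_mono ((hf x).integrable_div_sq_add_sq hr)
            (integrable_finsetSum _ fun j _ => (hK j _ (hx j) r hr).1) fun s => ?_
          simp only [← Finset.sum_div]
          gcongr
          exact log_smul_le_sum hn hg1 hgsub _ s
      _ = ∑ j, ∫ s, Real.log (g (((x : EuclideanSpace ℝ (Fin n)) j * s) •
            EuclideanSpace.single j (1 : ℝ))) / (s ^ 2 + r ^ 2) :=
          integral_finsetSum _ fun j _ => (hK j _ (hx j) r hr).1
      _ ≤ ∑ j, K j r := Finset.sum_le_sum fun j _ => (hK j _ (hx j) r hr).2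
  have hSbdd : ∀ r, 1 ≤ r → BddAbove (range fun x : Metric.sphere
      (0 : EuclideanSpace ℝ (Fin n)) 1 => Sfun n g x r) := fun r hr =>
    ⟨_, forall_mem_range.2 (hSK r hr)⟩
  have hSsup0 : ∀ r, 0 ≤ Ssup n g r := fun r => Real.iSup_nonneg fun x => hS0 x r
  have hSle : ∀ r, 1 ≤ r → ∀ x : Metric.sphere (0 : EuclideanSpace ℝ (Fin n)) 1,
      Sfun n g x r ≤ Ssup n g r := fun r hr x => le_ciSup (hSbdd r hr) x
  refine ⟨fun r hr => ?_, ?_⟩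
  · have hmax : max r 1 = r := max_eq_left hr.le
    have hIS : ∀ x : Metric.sphere (0 : EuclideanSpace ℝ (Fin n)) 1,
        Ifun n g x r ≤ 2 * Real.pi * Ssup n g r := by
      intro x
      have h := (hf x).integral_Ioi_div_sq_le hr.le
      have hS := mul_le_mul_of_nonneg_left (hSle r hr.le x) (by positivity : 0 ≤ 2 * Real.pi)
      refine le_trans ?_ hS
      rw [Ifun, Sfun, hmax, mul_assoc 2, mul_inv_cancel_left₀ hpi.ne']
      exact h
    have hJS : ∀ x : Metric.sphere (0 : EuclideanSpace ℝ (Fin n)) 1,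
        Jfun n g x r ≤ 2 * Real.pi * Ssup n g r := by
      intro x
      have h := (hf x).inv_sq_mul_integral_Ioc_le hr.le
      have hS := mul_le_mul_of_nonneg_left (hSle r hr.le x) (by positivity : 0 ≤ 2 * Real.pi)
      refine le_trans ?_ hS
      rw [Jfun, Sfun, hmax, mul_assoc 2, mul_inv_cancel_left₀ hpi.ne']
      exact h
    have hIle : ∀ x : Metric.sphere (0 : EuclideanSpace ℝ (Fin n)) 1,
        Ifun n g x r ≤ Isup n g r := fun x => le_ciSup ⟨_, forall_mem_range.2 hIS⟩ x
    have hJle : ∀ x : Metric.sphere (0 : EuclideanSpace ℝ (Fin n)) 1,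
        Jfun n g x r ≤ Jsup n g r := fun x => le_ciSup ⟨_, forall_mem_range.2 hJS⟩ x
    have hrhs : 0 ≤ 2 * Real.pi * Ssup n g r := mul_nonneg (by positivity) (hSsup0 r)
    refine ⟨?_, Real.iSup_le (fun x => ?_) (mul_nonneg (by positivity)
      (add_nonneg (Real.iSup_nonneg fun x => hI0 x r) (Real.iSup_nonneg fun x => hJ0 x r)))⟩
    · rw [inv_mul_le_iff₀ (by positivity)]
      exact max_le (Real.iSup_le hIS hrhs) (Real.iSup_le hJS hrhs)
    · have h := (hf x).integral_div_sq_add_sq_le hr.le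
      have h1 := hIle x
      have h2 := hJle x
      have h3 := hIle (-x)
      have h4 := hJle (-x)
      simp only [Ifun, Jfun, hmax, coe_neg_sphere, smul_neg] at h1 h2 h3 h4
      simp only [neg_smul] at h
      rw [Sfun, hmax, div_mul_eq_mul_div, inv_mul_eq_div]
      gcongr
      linarith
  · have hlim : Tendsto (fun r => Real.pi⁻¹ * ∑ j, K j r) atTop (𝓝 0) := by
      simpa using (tendsto_finsetSum Finset.univ fun j _ => hK0 j).const_mul Real.pi⁻¹
    refine squeeze_zero' (.of_forall hSsup0) ?_ hlim
    filter_upwards [eventually_ge_atTop 1] with r hr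
    have : NeZero n := ⟨by omega⟩
    have : Nonempty (Metric.sphere (0 : EuclideanSpace ℝ (Fin n)) 1) :=
      ⟨⟨EuclideanSpace.single 0 1, by simp⟩⟩
    exact ciSup_le (hSK r hr)
end

section
/- Let n ≥ 1, s ≥ 0, and g(x) := (1 + |x|)^s for x ∈ ℝ^n. Then for every r ≥ 1: S_g(r) ≤ c₁ s / r + s log(1+r)/r, where c₁ := (1/π) ∫_{−∞}^∞ log(1+|λ|)/(λ²+1) dλ. -/
open MeasureTheory

lemma log_one_add_abs_div_le (x : ℝ) :
    Real.log (1 + |x|) / (x ^ 2 + 1) ≤ 4 * (1 + |x|) ^ (-(3 / 2) : ℝ) := by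
  have hpos : 0 < 1 + |x| := by positivity
  have hlog : Real.log (1 + |x|) ≤ 2 * (1 + |x|) ^ (1 / 2 : ℝ) := by
    have := Real.log_le_rpow_div hpos.le (ε := 1 / 2) (by norm_num)
    linarith
  have hsplit : (1 + |x|) ^ (1 / 2 : ℝ) = (1 + |x|) ^ (-(3 / 2) : ℝ) * (1 + |x|) ^ 2 := by
    rw [← Real.rpow_natCast, ← Real.rpow_add hpos]
    norm_num
  have hsq : (1 + |x|) ^ 2 ≤ 2 * (x ^ 2 + 1) := by
    nlinarith [sq_nonneg (|x| - 1), sq_abs x]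
  rw [div_le_iff₀ (by positivity)]
  calc Real.log (1 + |x|) ≤ 2 * ((1 + |x|) ^ (-(3 / 2) : ℝ) * (1 + |x|) ^ 2) := hsplit ▸ hlog
    _ ≤ 2 * ((1 + |x|) ^ (-(3 / 2) : ℝ) * (2 * (x ^ 2 + 1))) := by gcongr
    _ = 4 * (1 + |x|) ^ (-(3 / 2) : ℝ) * (x ^ 2 + 1) := by ring

lemma log_one_add_abs_nonneg (x : ℝ) : 0 ≤ Real.log (1 + |x|) :=
  Real.log_nonneg (by linarith [abs_nonneg x])

lemma integrable_log_one_add_abs_div :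
    Integrable fun x : ℝ => Real.log (1 + |x|) / (x ^ 2 + 1) := by
  have hdom : Integrable fun x : ℝ => 4 * (1 + ‖x‖) ^ (-(3 / 2) : ℝ) :=
    (integrable_one_add_norm (by norm_num)).const_mul 4
  refine hdom.mono' (Measurable.aestronglyMeasurable (by fun_prop)) (.of_forall fun x => ?_)
  rw [Real.norm_of_nonneg (div_nonneg (log_one_add_abs_nonneg x) (by positivity))]
  exact log_one_add_abs_div_le x

lemma integral_log_one_add_abs_div_sq_add_sq {r : ℝ} (hr : 0 < r) :
    ∫ x : ℝ, Real.log (1 + |x|) / (x ^ 2 + r ^ 2) =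
      r⁻¹ * ∫ x : ℝ, Real.log (1 + r * |x|) / (x ^ 2 + 1) := by
  have hsub := Measure.integral_comp_mul_left
    (fun x : ℝ => Real.log (1 + |x|) / (x ^ 2 + r ^ 2)) r
  rw [abs_of_pos (inv_pos.2 hr), smul_eq_mul, eq_comm, inv_mul_eq_iff_eq_mul₀ hr.ne'] at hsub
  rw [hsub, ← integral_const_mul, ← integral_const_mul]
  refine integral_congr_ae (.of_forall fun x => ?_)
  have hx : x ^ 2 + 1 ≠ 0 := by positivity
  simp only [abs_mul, abs_of_pos hr]
  rw [show (r * x) ^ 2 + r ^ 2 = r ^ 2 * (x ^ 2 + 1) by ring]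
  field_simp

lemma integral_log_one_add_mul_abs_div_le {r : ℝ} (hr : 0 ≤ r) :
    ∫ x : ℝ, Real.log (1 + r * |x|) / (x ^ 2 + 1) ≤
      (∫ x : ℝ, Real.log (1 + |x|) / (x ^ 2 + 1)) + Real.log (1 + r) * Real.pi := by
  have hcauchy : Integrable fun x : ℝ => Real.log (1 + r) * (1 + x ^ 2)⁻¹ :=
    integrable_inv_one_add_sq.const_mul _
  rw [← integral_univ_inv_one_add_sq, ← integral_const_mul,
    ← integral_add integrable_log_one_add_abs_div hcauchy]
  refine integral_mono_of_nonneg (.of_forall fun x => ?_)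
    (integrable_log_one_add_abs_div.add hcauchy) (.of_forall fun x => ?_)
  · exact div_nonneg (Real.log_nonneg (by linarith [mul_nonneg hr (abs_nonneg x)]))
      (by positivity)
  · have hlog : Real.log (1 + r * |x|) ≤ Real.log (1 + |x|) + Real.log (1 + r) := by
      rw [← Real.log_mul (by positivity) (by positivity)]
      exact Real.log_le_log (by positivity) (by nlinarith [abs_nonneg x])
    calc Real.log (1 + r * |x|) / (x ^ 2 + 1)
        ≤ (Real.log (1 + |x|) + Real.log (1 + r)) / (x ^ 2 + 1) := by gcongr
      _ = Real.log (1 + |x|) / (x ^ 2 + 1) + Real.log (1 + r) * (1 + x ^ 2)⁻¹ := by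
        rw [add_div, add_comm (x ^ 2), div_eq_mul_inv (Real.log (1 + r))]

/-- estimate `\eqref{s}`: for `g(x) = (1+|x|)^s`, `s ≥ 0`, and every `r ≥ 1`,
`S_g(r) ≤ c₁ s/r + s log(1+r)/r` with `c₁ = (1/π)∫ log(1+|λ|)/(λ²+1) dλ`. -/
theorem statement5 (n : ℕ) (hn : 1 ≤ n) (s : ℝ) (hs : 0 ≤ s)
    (g : EuclideanSpace ℝ (Fin n) → ℝ)
    (hg : g = fun x => (1 + ‖x‖) ^ s)
    (c₁ : ℝ)
    (hc₁ : c₁ = Real.pi⁻¹ * ∫ lam : ℝ, Real.log (1 + |lam|) / (lam ^ 2 + 1)) :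
    ∀ r : ℝ, 1 ≤ r →
      Ssup n g r ≤ c₁ * s / r + s * Real.log (1 + r) / r := by
  subst hg hc₁
  intro r hr
  have hr0 : 0 < r := by linarith
  have hint : 0 ≤ ∫ x : ℝ, Real.log (1 + |x|) / (x ^ 2 + 1) :=
    integral_nonneg fun x => div_nonneg (log_one_add_abs_nonneg x) (by positivity)
  have hlog : 0 ≤ Real.log (1 + r) := Real.log_nonneg (by linarith)
  refine Real.iSup_le (fun ⟨x, hx⟩ => ?_) (by positivity)
  have hnorm : ‖x‖ = 1 := by simpa using hx
  have hs_out : Sfun n (fun x => (1 + ‖x‖) ^ s) x r =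
      Real.pi⁻¹ * (s * ∫ τ : ℝ, Real.log (1 + |τ|) / (τ ^ 2 + r ^ 2)) := by
    rw [Sfun, ← integral_const_mul s, max_eq_left hr]
    congr 1
    refine integral_congr_ae (.of_forall fun τ => ?_)
    beta_reduce
    rw [norm_smul, hnorm, mul_one, Real.norm_eq_abs, Real.log_rpow (by positivity), mul_div_assoc]
  rw [hs_out, integral_log_one_add_abs_div_sq_add_sq hr0]
  calc _ ≤ Real.pi⁻¹ * (s * (r⁻¹ * ((∫ x : ℝ, Real.log (1 + |x|) / (x ^ 2 + 1)) +
        Real.log (1 + r) * Real.pi))) := by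
        gcongr
        exact integral_log_one_add_mul_abs_div_le hr0.le
    _ = _ := by
        field_simp [Real.pi_ne_zero]
end

section
/- Let n ≥ 1, t ≥ 0, and g(x) := (log(e + |x|))^t for x ∈ ℝ^n. Then for every r ≥ 1: S_g(r) ≤ c₂ t / r + t log log(e+r)/r, where c₂ := (1/π) ∫_{−∞}^∞ log(2 log(e+|λ|))/(λ²+1) dλ. -/
open MeasureTheory

/-- `log (e + s) ≥ 1` for `s ≥ 0`. -/
theorem one_le_log_exp_one_add {s : ℝ} (hs : 0 ≤ s) : 1 ≤ Real.log (Real.exp 1 + s) := by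
  rw [Real.le_log_iff_exp_le (by positivity)]
  linarith

theorem log_log_exp_one_add_mul_le {r s : ℝ} (hr : 0 ≤ r) (hs : 0 ≤ s) :
    Real.log (Real.log (Real.exp 1 + r * s)) ≤
      Real.log (Real.log (Real.exp 1 + r)) + Real.log (2 * Real.log (Real.exp 1 + s)) := by
  have hr1 := one_le_log_exp_one_add hr
  have hs1 := one_le_log_exp_one_add hs
  have hrs1 := one_le_log_exp_one_add (mul_nonneg hr hs)
  have he : 1 ≤ Real.exp 1 := Real.one_le_exp zero_le_one
  have hsub : Real.log (Real.exp 1 + r * s) ≤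
      Real.log (Real.exp 1 + r) + Real.log (Real.exp 1 + s) := by
    rw [← Real.log_mul (by positivity) (by positivity)]
    apply Real.log_le_log (by positivity)
    nlinarith [mul_nonneg hr (Real.exp_pos 1).le, mul_nonneg hs (Real.exp_pos 1).le]
  rw [← Real.log_mul (by positivity) (by positivity)]
  apply Real.log_le_log (by positivity)
  nlinarith [mul_nonneg (sub_nonneg.2 hr1) (sub_nonneg.2 hs1)]

theorem log_two_mul_log_exp_one_add_le (s : ℝ) :
    Real.log (2 * Real.log (Real.exp 1 + |s|)) ≤ 8 * (1 + s ^ 2) ^ (1 / 4 : ℝ) := by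
  have hL := one_le_log_exp_one_add (abs_nonneg s)
  have hexp : Real.exp 1 + |s| ≤ 4 * (1 + s ^ 2) ^ (1 / 2 : ℝ) := by
    rw [← Real.sqrt_eq_rpow]
    have h1 : 1 ≤ √(1 + s ^ 2) := Real.one_le_sqrt.2 (by nlinarith [sq_nonneg s])
    have h2 : |s| ≤ √(1 + s ^ 2) := Real.abs_le_sqrt (by linarith)
    linarith [Real.exp_one_lt_d9]
  have hpow : (Real.exp 1 + |s|) ^ (1 / 2 : ℝ) ≤ 2 * (1 + s ^ 2) ^ (1 / 4 : ℝ) := by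
    refine (Real.rpow_le_rpow (by positivity) hexp (by norm_num)).trans_eq ?_
    rw [Real.mul_rpow (by norm_num) (by positivity), ← Real.rpow_mul (by positivity),
      ← Real.sqrt_eq_rpow, show (4 : ℝ) = 2 ^ 2 by norm_num, Real.sqrt_sq (by norm_num)]
    norm_num
  have hlog := Real.log_le_rpow_div (x := Real.exp 1 + |s|) (by positivity)
    (show (0 : ℝ) < 1 / 2 by norm_num)
  have hle := Real.log_le_self (x := 2 * Real.log (Real.exp 1 + |s|)) (by positivity)
  linarith

theorem integrable_log_two_mul_log_exp_one_add_div :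
    Integrable fun s : ℝ => Real.log (2 * Real.log (Real.exp 1 + |s|)) / (s ^ 2 + 1) := by
  have hdom : Integrable fun s : ℝ => 8 * (1 + ‖s‖ ^ 2) ^ (-(3 / 2 : ℝ) / 2) :=
    (integrable_rpow_neg_one_add_norm_sq (by norm_num)).const_mul 8
  refine hdom.mono' (Measurable.aestronglyMeasurable (by fun_prop)) (ae_of_all _ fun s => ?_)
  have hL := one_le_log_exp_one_add (abs_nonneg s)
  have hpos : 0 < 1 + s ^ 2 := by positivity
  rw [Real.norm_of_nonneg (div_nonneg (Real.log_nonneg (by linarith)) (by positivity)),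
    div_le_iff₀ (by positivity), Real.norm_eq_abs, sq_abs, add_comm (s ^ 2) 1, mul_assoc,
    ← Real.rpow_add_one hpos.ne']
  rw [show (-(3 / 2) / 2 + 1 : ℝ) = 1 / 4 by norm_num]
  exact log_two_mul_log_exp_one_add_le s

theorem integral_log_log_exp_one_add_div_le {r : ℝ} (hr : 0 < r) :
    ∫ τ : ℝ, Real.log (Real.log (Real.exp 1 + |τ|)) / (τ ^ 2 + r ^ 2) ≤
      r⁻¹ * (Real.log (Real.log (Real.exp 1 + r)) * Real.pi +
        ∫ s : ℝ, Real.log (2 * Real.log (Real.exp 1 + |s|)) / (s ^ 2 + 1)) := by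
  have hscale := Measure.integral_comp_mul_left
    (fun τ : ℝ => Real.log (Real.log (Real.exp 1 + |τ|)) / (τ ^ 2 + r ^ 2)) r
  rw [abs_of_pos (inv_pos.2 hr), smul_eq_mul, eq_inv_mul_iff_mul_eq₀ hr.ne'] at hscale
  have hconst : Integrable fun s : ℝ =>
      Real.log (Real.log (Real.exp 1 + r)) * (1 + s ^ 2)⁻¹ :=
    integrable_inv_one_add_sq.const_mul _
  rw [← hscale, ← integral_univ_inv_one_add_sq,
    ← integral_const_mul (Real.log (Real.log (Real.exp 1 + r))),
    ← integral_add hconst integrable_log_two_mul_log_exp_one_add_div,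
    ← integral_const_mul, ← integral_const_mul]
  refine integral_mono_of_nonneg (ae_of_all _ fun s => ?_)
    ((hconst.add integrable_log_two_mul_log_exp_one_add_div).const_mul _)
    (ae_of_all _ fun s => ?_)
  · exact mul_nonneg hr.le (div_nonneg
      (Real.log_nonneg (one_le_log_exp_one_add (abs_nonneg _))) (by positivity))
  · have hbound := log_log_exp_one_add_mul_le hr.le (abs_nonneg s)
    have hpos : 0 < 1 + s ^ 2 := by positivity
    calc r * (Real.log (Real.log (Real.exp 1 + |r * s|)) / ((r * s) ^ 2 + r ^ 2))
        = r⁻¹ * (Real.log (Real.log (Real.exp 1 + r * |s|)) / (1 + s ^ 2)) := by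
          rw [abs_mul, abs_of_pos hr, show (r * s) ^ 2 + r ^ 2 = r ^ 2 * (1 + s ^ 2) by ring]
          field_simp
      _ ≤ r⁻¹ * ((Real.log (Real.log (Real.exp 1 + r)) +
            Real.log (2 * Real.log (Real.exp 1 + |s|))) / (1 + s ^ 2)) := by gcongr
      _ = _ := by
          simp only [add_mul, div_eq_mul_inv, add_comm (s ^ 2) 1]

/-- estimate `\eqref{t}`: for `g(x) = (log(e+|x|))^t`, `t ≥ 0`, and every
`r ≥ 1`, `S_g(r) ≤ c₂ t/r + t log log(e+r)/r` with
`c₂ = (1/π)∫ log(2 log(e+|λ|))/(λ²+1) dλ`. -/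
theorem statement6 (n : ℕ) (hn : 1 ≤ n) (t : ℝ) (ht : 0 ≤ t)
    (g : EuclideanSpace ℝ (Fin n) → ℝ)
    (hg : g = fun x => (Real.log (Real.exp 1 + ‖x‖)) ^ t)
    (c₂ : ℝ)
    (hc₂ : c₂ = Real.pi⁻¹ *
      ∫ lam : ℝ, Real.log (2 * Real.log (Real.exp 1 + |lam|)) / (lam ^ 2 + 1)) :
    ∀ r : ℝ, 1 ≤ r →
      Ssup n g r ≤ c₂ * t / r + t * Real.log (Real.log (Real.exp 1 + r)) / r := by
  intro r hr
  have hr0 : 0 < r := by linarith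
  have : Nonempty (Metric.sphere (0 : EuclideanSpace ℝ (Fin n)) 1) :=
    ⟨⟨EuclideanSpace.single ⟨0, hn⟩ 1, by simp⟩⟩
  refine ciSup_le fun x => ?_
  have hx : ‖(x : EuclideanSpace ℝ (Fin n))‖ = 1 := by simp
  have hlog (τ : ℝ) : Real.log (g (τ • (x : EuclideanSpace ℝ (Fin n)))) =
      t * Real.log (Real.log (Real.exp 1 + |τ|)) := by
    have hL := one_le_log_exp_one_add (abs_nonneg τ)
    simp only [hg, norm_smul, hx, mul_one, Real.norm_eq_abs]
    exact Real.log_rpow (by linarith) t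
  simp only [Sfun, hlog, max_eq_left hr, mul_div_assoc, integral_const_mul]
  calc _ ≤ Real.pi⁻¹ * (t * (r⁻¹ * (Real.log (Real.log (Real.exp 1 + r)) * Real.pi +
        ∫ s : ℝ, Real.log (2 * Real.log (Real.exp 1 + |s|)) / (s ^ 2 + 1)))) := by
        gcongr
        exact integral_log_log_exp_one_add_div_le hr0
    _ = _ := by
        rw [hc₂]
        field_simp
        ring
end

section
/- Let n ≥ 1, a ≥ 0, b ∈ [0,1), and g(x) := e^{a|x|^b} for x ∈ ℝ^n. Then for every r ≥ 1: S_g(r) = a r^{b−1} / sin((1−b)π/2). -/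
open MeasureTheory

open Real Set in
/-- The partial Gaussian moment integral with damping factor `e^{-t r²}`. -/
theorem integral_rpow_mul_exp_neg_mul_sq_add_sq {b t : ℝ} (hb : -1 < b) (ht : 0 < t) (r : ℝ) :
    ∫ τ in Ioi (0 : ℝ), τ ^ b * exp (-(t * (τ ^ 2 + r ^ 2))) =
      Gamma ((b + 1) / 2) / 2 * (t ^ ((1 - b) / 2 - 1) * exp (-(r ^ 2 * t))) := by
  have key := integral_rpow_mul_exp_neg_mul_rpow (p := 2) two_pos hb ht
  have hsplit : ∀ τ : ℝ, τ ^ b * exp (-(t * (τ ^ 2 + r ^ 2))) =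
      τ ^ b * exp (-t * τ ^ (2 : ℝ)) * exp (-(r ^ 2 * t)) := fun τ => by
    rw [mul_assoc, ← exp_add, rpow_two]
    ring_nf
  simp_rw [hsplit]
  rw [integral_mul_const, key, show (1 - b) / 2 - 1 = -(b + 1) / 2 by ring]
  ring

open Real Set in
theorem integrableOn_rpow_mul_exp_neg_mul_sq_add_sq {b t : ℝ} (hb : -1 < b) (ht : 0 < t) (r : ℝ) :
    IntegrableOn (fun τ : ℝ => τ ^ b * exp (-(t * (τ ^ 2 + r ^ 2)))) (Ioi 0) := by
  refine ((integrableOn_rpow_mul_exp_neg_mul_sq ht hb).mul_const (exp (-(r ^ 2 * t)))).congr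
    (ae_of_all _ fun τ => ?_)
  simp only
  rw [mul_assoc, ← exp_add]
  ring_nf

open Real Set in
theorem integrable_prod_rpow_mul_exp_neg_mul_sq_add_sq {b r : ℝ} (hb : -1 < b) (hb1 : b < 1)
    (hr : 0 < r) :
    Integrable (Function.uncurry fun t τ : ℝ => τ ^ b * exp (-(t * (τ ^ 2 + r ^ 2))))
      ((volume.restrict (Ioi 0)).prod (volume.restrict (Ioi 0))) := by
  rw [integrable_prod_iff]
  · refine ⟨?_, ?_⟩
    · filter_upwards [ae_restrict_mem measurableSet_Ioi] with t ht
      exact integrableOn_rpow_mul_exp_neg_mul_sq_add_sq hb ht r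
    · have hint : IntegrableOn (fun t : ℝ => Gamma ((b + 1) / 2) / 2 *
          (t ^ ((1 - b) / 2 - 1) * exp (-(r ^ 2 * t)))) (Ioi 0) := by
        refine ((integrableOn_rpow_mul_exp_neg_mul_rpow (p := 1) (s := (1 - b) / 2 - 1)
          (b := r ^ 2) (by linarith) one_pos (by positivity)).congr
          (ae_of_all _ fun t => ?_)).const_mul _
        simp
      refine hint.congr ?_
      filter_upwards [ae_restrict_mem measurableSet_Ioi] with t ht
      rw [← integral_rpow_mul_exp_neg_mul_sq_add_sq hb ht r]
      refine setIntegral_congr_fun measurableSet_Ioi fun τ hτ => ?_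
      have : (0 : ℝ) < τ := hτ
      exact (norm_of_nonneg (mul_nonneg (rpow_nonneg this.le b) (exp_nonneg _))).symm
  · refine Measurable.aestronglyMeasurable ?_
    simp only [Function.uncurry_def]
    fun_prop

open Real Set in
theorem integral_rpow_div_sq_add_sq_Ioi {b r : ℝ} (hb : -1 < b) (hb1 : b < 1) (hr : 0 < r) :
    ∫ τ in Ioi (0 : ℝ), τ ^ b / (τ ^ 2 + r ^ 2) =
      π / 2 * (r ^ (b - 1) / sin ((1 - b) * π / 2)) := by
  have hinner : ∀ τ : ℝ, ∫ t in Ioi (0 : ℝ), τ ^ b * exp (-(t * (τ ^ 2 + r ^ 2))) =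
      τ ^ b / (τ ^ 2 + r ^ 2) := fun τ => by
    have hneg : -(τ ^ 2 + r ^ 2) < 0 := by nlinarith [sq_nonneg τ]
    have h := integral_exp_mul_Ioi hneg 0
    rw [integral_const_mul, div_eq_mul_inv]
    congr 1
    rw [mul_zero, exp_zero, neg_div_neg_eq, one_div] at h
    rw [← h]
    congr with t
    ring_nf
  calc ∫ τ in Ioi (0 : ℝ), τ ^ b / (τ ^ 2 + r ^ 2)
      = ∫ τ in Ioi (0 : ℝ), ∫ t in Ioi (0 : ℝ), τ ^ b * exp (-(t * (τ ^ 2 + r ^ 2))) := by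
        simp_rw [hinner]
    _ = ∫ t in Ioi (0 : ℝ), ∫ τ in Ioi (0 : ℝ), τ ^ b * exp (-(t * (τ ^ 2 + r ^ 2))) :=
        (integral_integral_swap (integrable_prod_rpow_mul_exp_neg_mul_sq_add_sq hb hb1 hr)).symm
    _ = ∫ t in Ioi (0 : ℝ),
          Gamma ((b + 1) / 2) / 2 * (t ^ ((1 - b) / 2 - 1) * exp (-(r ^ 2 * t))) :=
        setIntegral_congr_fun measurableSet_Ioi fun t ht =>
          integral_rpow_mul_exp_neg_mul_sq_add_sq hb ht r
    _ = π / 2 * (r ^ (b - 1) / sin ((1 - b) * π / 2)) := by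
        have hpow : (1 / r ^ 2) ^ ((1 - b) / 2) = r ^ (b - 1) := by
          rw [one_div, ← rpow_two, ← rpow_neg hr.le, ← rpow_mul hr.le]
          ring_nf
        have hrefl := Gamma_mul_Gamma_one_sub ((1 - b) / 2)
        rw [show 1 - (1 - b) / 2 = (b + 1) / 2 by ring,
          show π * ((1 - b) / 2) = (1 - b) * π / 2 by ring] at hrefl
        rw [integral_const_mul, integral_rpow_mul_exp_neg_mul_Ioi (by linarith) (by positivity),
          hpow]
        linear_combination r ^ (b - 1) / 2 * hrefl

open Real Set in
theorem integral_abs_rpow_div_sq_add_sq {b r : ℝ} (hb : -1 < b) (hb1 : b < 1) (hr : 0 < r) :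
    ∫ τ : ℝ, |τ| ^ b / (τ ^ 2 + r ^ 2) = π * (r ^ (b - 1) / sin ((1 - b) * π / 2)) := by
  have h := integral_comp_abs (f := fun τ : ℝ => τ ^ b / (τ ^ 2 + r ^ 2))
  simp only [sq_abs] at h
  rw [h, integral_rpow_div_sq_add_sq_Ioi hb hb1 hr]
  ring

/-- identity `\eqref{ab}`: for `g(x) = e^{a|x|^b}`, `a ≥ 0`, `b ∈ [0,1)`,
and every `r ≥ 1`, `S_g(r) = a r^{b−1} / sin((1−b)π/2)`. -/
theorem statement7 (n : ℕ) (hn : 1 ≤ n) (a b : ℝ) (ha : 0 ≤ a) (hb : b ∈ Set.Ico (0 : ℝ) 1)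
    (g : EuclideanSpace ℝ (Fin n) → ℝ)
    (hg : g = fun x => Real.exp (a * ‖x‖ ^ b)) :
    ∀ r : ℝ, 1 ≤ r →
      Ssup n g r = a * r ^ (b - 1) / Real.sin ((1 - b) * Real.pi / 2) := by
  intro r hr
  have hr0 : 0 < r := one_pos.trans_le hr
  have hS : ∀ x : Metric.sphere (0 : EuclideanSpace ℝ (Fin n)) 1,
      Sfun n g x r = a * r ^ (b - 1) / Real.sin ((1 - b) * Real.pi / 2) := fun x => by
    have hx : ‖(x : EuclideanSpace ℝ (Fin n))‖ = 1 := norm_eq_of_mem_sphere x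
    have hint := integral_abs_rpow_div_sq_add_sq (by linarith [hb.1]) hb.2 hr0
    simp only [Sfun, hg, Real.log_exp, norm_smul, hx, mul_one, Real.norm_eq_abs, max_eq_left hr,
      mul_div_assoc]
    rw [integral_const_mul, hint]
    field_simp
  have : Nonempty (Fin n) := ⟨⟨0, hn⟩⟩
  have : Nonempty (Metric.sphere (0 : EuclideanSpace ℝ (Fin n)) 1) :=
    (NormedSpace.sphere_nonempty.mpr zero_le_one).to_subtype
  simp only [Ssup, hS, ciSup_const]
end

section
/- Let ε > 0, let τ > 0 satisfy (1 + τ²)^{1/4} cos((1/2) arctan(1/τ)) ≤ (1+ε)/√2, and let κ ≥ 1 satisfy ((1+ε)/√2) κ^{1/2} ≥ (1 + 1/τ²)^{1/4}. Then for every (x₁, x₂) ∈ ℝ²: Re √(x₁ + i κ x₂) ≤ ((1+ε)/√2) κ^{1/2} (x₁² + x₂²)^{1/4}, where √· denotes the principal branch of the complex square root (analytic on ℂ \ (−∞,0], positive on (0,∞)). -/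
theorem Real.rpow_one_div_four_eq_sqrt_sqrt {a : ℝ} (ha : 0 ≤ a) :
    a ^ ((1 : ℝ) / 4) = √√a := by
  rw [Real.sqrt_eq_rpow, Real.sqrt_eq_rpow, ← Real.rpow_mul ha]
  norm_num

theorem Real.sqrt_mul_cos_half_arctan_inv_sq {τ : ℝ} (hτ : 0 < τ) :
    √(1 + τ ^ 2) * Real.cos (Real.arctan (1 / τ) / 2) ^ 2 = (√(1 + τ ^ 2) + τ) / 2 := by
  have hS : 0 < √(1 + τ ^ 2) := by positivity
  have h : √(1 + (1 / τ) ^ 2) = √(1 + τ ^ 2) / τ := by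
    rw [← Real.sqrt_sq hτ.le, ← Real.sqrt_div (by positivity), Real.sqrt_sq hτ.le]
    congr 1
    field_simp
    ring
  rw [Real.cos_sq, mul_div_cancel₀ _ two_ne_zero, Real.cos_arctan, h]
  field_simp

/-- The squared form of the estimate, with `c` in place of `((1+ε)/√2)²`. -/
theorem half_sqrt_add_le {c τ κ : ℝ} (hτ : 0 < τ) (hκ : 1 ≤ κ) (hc : 1 / 2 ≤ c)
    (h₁ : (√(1 + τ ^ 2) + τ) / 2 ≤ c) (h₂ : √(1 + 1 / τ ^ 2) ≤ c * κ) (x y : ℝ) :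
    (√(x ^ 2 + (κ * y) ^ 2) + x) / 2 ≤ c * κ * √(x ^ 2 + y ^ 2) := by
  have hκ₀ : 0 < κ := by linarith
  have hcκ : 0 < c * κ := by positivity
  have hκy : 0 ≤ κ * |y| := by positivity
  have hx : x ≤ √(x ^ 2 + y ^ 2) := Real.le_sqrt_of_sq_le (by nlinarith [sq_nonneg y])
  have hy : |y| ≤ √(x ^ 2 + y ^ 2) := Real.abs_le_sqrt (by nlinarith [sq_nonneg x])
  have hyy : (κ * y) ^ 2 = (κ * |y|) ^ 2 := by rw [mul_pow, mul_pow, sq_abs]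
  rw [hyy]
  rcases le_total x (τ * (κ * |y|)) with hxy | hxy
  · refine le_trans ?_ (mul_le_mul_of_nonneg_left hy hcκ.le)
    rcases le_total x 0 with hx₀ | hx₀
    · have h : √(x ^ 2 + (κ * |y|) ^ 2) ≤ κ * |y| - x :=
        Real.sqrt_le_iff.2 ⟨by linarith, by nlinarith⟩
      nlinarith
    · have h : √(x ^ 2 + (κ * |y|) ^ 2) ≤ √(1 + τ ^ 2) * (κ * |y|) := by
        rw [Real.sqrt_le_iff, mul_pow (√_), Real.sq_sqrt (by positivity)]
        exact ⟨by positivity, by nlinarith [pow_le_pow_left₀ hx₀ hxy 2]⟩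
      nlinarith [mul_le_mul_of_nonneg_right h₁ hκy]
  · have hx₀ : 0 ≤ x := le_trans (by positivity) hxy
    have h : √(x ^ 2 + (κ * |y|) ^ 2) ≤ √(1 + 1 / τ ^ 2) * x := by
      rw [Real.sqrt_le_iff, mul_pow (√_), Real.sq_sqrt (by positivity)]
      refine ⟨by positivity, ?_⟩
      have : κ * |y| ≤ x / τ := by rw [le_div_iff₀ hτ]; linarith
      calc x ^ 2 + (κ * |y|) ^ 2 ≤ x ^ 2 + (x / τ) ^ 2 := by gcongr
        _ = (1 + 1 / τ ^ 2) * x ^ 2 := by ring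
    have hle : x ≤ √(x ^ 2 + (κ * |y|) ^ 2) :=
      Real.le_sqrt_of_sq_le (by nlinarith [sq_nonneg (κ * |y|)])
    nlinarith [mul_le_mul_of_nonneg_right h₂ hx₀, mul_le_mul_of_nonneg_left hx hcκ.le]

/-- estimate `\eqref{sqrt}`: if `(1+τ²)^{1/4} cos((1/2) arctan(1/τ)) ≤
(1+ε)/√2` and `((1+ε)/√2)√κ ≥ (1+1/τ²)^{1/4}` with `κ ≥ 1`, then for all `(x₁,x₂) ∈ ℝ²`,
`Re √(x₁ + iκx₂) ≤ ((1+ε)/√2) √κ (x₁²+x₂²)^{1/4}` (principal branch of the square root). -/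
theorem statement17 (ε τ κ : ℝ) (hε : 0 < ε) (hτ : 0 < τ)
    (hτε : (1 + τ ^ 2) ^ ((1 : ℝ) / 4) * Real.cos (Real.arctan (1 / τ) / 2)
      ≤ (1 + ε) / Real.sqrt 2)
    (hκ : 1 ≤ κ)
    (hκε : (1 + 1 / τ ^ 2) ^ ((1 : ℝ) / 4) ≤ (1 + ε) / Real.sqrt 2 * Real.sqrt κ) :
    ∀ x₁ x₂ : ℝ,
      (((x₁ : ℂ) + (κ : ℂ) * (x₂ : ℂ) * Complex.I) ^ ((1 : ℂ) / 2)).re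
        ≤ (1 + ε) / Real.sqrt 2 * Real.sqrt κ * (x₁ ^ 2 + x₂ ^ 2) ^ ((1 : ℝ) / 4) := by
  intro x₁ x₂
  have hA : 0 < (1 + ε) / √2 := by positivity
  have hκ₀ : 0 ≤ κ := by linarith
  have hc : 1 / 2 ≤ ((1 + ε) / √2) ^ 2 := by
    rw [div_pow, Real.sq_sqrt zero_le_two]
    nlinarith
  have hcos : 0 ≤ Real.cos (Real.arctan (1 / τ) / 2) := by
    apply Real.cos_nonneg_of_mem_Icc
    constructor <;>
      linarith [Real.arctan_lt_pi_div_two (1 / τ), Real.neg_pi_div_two_lt_arctan (1 / τ),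
        Real.pi_pos]
  rw [Real.rpow_one_div_four_eq_sqrt_sqrt (by positivity)] at hτε hκε ⊢
  have h₁ : (√(1 + τ ^ 2) + τ) / 2 ≤ ((1 + ε) / √2) ^ 2 := by
    rw [← Real.sqrt_mul_cos_half_arctan_inv_sq hτ]
    have h := pow_le_pow_left₀ (by positivity) hτε 2
    rwa [mul_pow, Real.sq_sqrt (by positivity)] at h
  have h₂ : √(1 + 1 / τ ^ 2) ≤ ((1 + ε) / √2) ^ 2 * κ := by
    have h := pow_le_pow_left₀ (by positivity) hκε 2
    rwa [mul_pow, Real.sq_sqrt (by positivity), Real.sq_sqrt hκ₀] at h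
  have hz : (x₁ : ℂ) + (κ : ℂ) * (x₂ : ℂ) * Complex.I
      = (x₁ : ℂ) + ((κ * x₂ : ℝ) : ℂ) * Complex.I := by push_cast; ring
  rw [hz, one_div, Complex.cpow_inv_two_re, Complex.norm_add_mul_I]
  refine Real.sqrt_le_iff.2 ⟨by positivity, ?_⟩
  rw [mul_pow (_ * √κ), mul_pow _ (√κ), Real.sq_sqrt hκ₀, Real.sq_sqrt (by positivity)]
  simpa using half_sqrt_add_le hτ hκ hc h₁ h₂ x₁ x₂
end
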